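/- arXiv:1207.5686 — 6 statements merged into one kernel-verified Lean document; each statement's English description precedes it below -/
import Mathlib

section
/- There exists a constant C_β > 0, depending only on β, such that every f ∈ ℰ whose distributional derivative f' also belongs to ℰ satisfies ‖f‖_ω ≤ C_β ‖f'‖_ω. -/
open MeasureTheory Complex
open scoped ContDiff

/-- Membership in `ℰ = L²(ℝ, cosh(βx) dx)`. -/
def memE (β : ℝ) (f : ℝ → ℂ) : Prop :=
  AEStronglyMeasurable f volume ∧
    Integrable (fun x : ℝ => ‖f x‖ ^ 2 * Real.cosh (β * x))

/-- The norm `‖f‖_ω = (∫ |f|² cosh(βx) dx)^{1/2}`. -/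
noncomputable def normE (β : ℝ) (f : ℝ → ℂ) : ℝ :=
  Real.sqrt (∫ x : ℝ, ‖f x‖ ^ 2 * Real.cosh (β * x))

/-- `f'` is the distributional derivative of `f`. -/
def IsDistribDeriv (f f' : ℝ → ℂ) : Prop :=
  ∀ φ : ℝ → ℂ, ContDiff ℝ ∞ φ → HasCompactSupport φ →
    ∫ x : ℝ, f x * deriv φ x = -∫ x : ℝ, f' x * φ x

open Set Filter Topology

/-- The weight `cosh` dominates a multiple of `1 + x²`. -/
lemma one_add_sq_le_four_mul_cosh (x : ℝ) : 1 + x ^ 2 ≤ 4 * Real.cosh x := by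
  rw [← Real.cosh_abs, Real.cosh_eq, ← sq_abs x]
  have h₁ := Real.quadratic_le_exp_of_nonneg (abs_nonneg x)
  have h₂ := Real.add_one_le_exp (-|x|)
  nlinarith

lemma integrable_inv_cosh_mul {β : ℝ} (hβ : β ≠ 0) :
    Integrable fun x : ℝ => (Real.cosh (β * x))⁻¹ := by
  have h : Integrable fun x : ℝ => 4 * (1 + (β * x) ^ 2)⁻¹ :=
    (integrable_inv_one_add_sq.comp_mul_left' hβ).const_mul 4
  refine h.mono' (by fun_prop) (ae_of_all _ fun x => ?_)
  have h₀ := one_add_sq_le_four_mul_cosh (β * x)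
  have hc := Real.cosh_pos (β * x)
  rw [Real.norm_of_nonneg (by positivity), ← div_eq_mul_inv, inv_eq_one_div,
    div_le_div_iff₀ hc (by positivity)]
  linarith

lemma memE.integrable {β : ℝ} (hβ : β ≠ 0) {f : ℝ → ℂ} (hf : memE β f) : Integrable f := by
  refine (hf.2.add (integrable_inv_cosh_mul hβ)).mono' hf.1 (ae_of_all _ fun x => ?_)
  have hc := Real.cosh_pos (β * x)
  have hn := norm_nonneg (f x)
  have h₁ : 0 ≤ (Real.cosh (β * x))⁻¹ * (‖f x‖ * Real.cosh (β * x) - 1) ^ 2 := by positivity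
  have h₂ : (Real.cosh (β * x))⁻¹ * (‖f x‖ * Real.cosh (β * x) - 1) ^ 2
      = ‖f x‖ ^ 2 * Real.cosh (β * x) - 2 * ‖f x‖ + (Real.cosh (β * x))⁻¹ := by
    field_simp
    ring
  simp only [Pi.add_apply]
  linarith

/-- A weak derivative identity between integrable functions extends to smooth bounded test
functions with bounded derivative. -/
lemma IsDistribDeriv.integral_mul_deriv {f g : ℝ → ℂ} (h : IsDistribDeriv f g)
    (hf : Integrable f) (hg : Integrable g) {Φ : ℝ → ℂ} (hΦ : ContDiff ℝ ∞ Φ) {M : ℝ}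
    (hM : ∀ x, ‖Φ x‖ ≤ M) {M' : ℝ} (hM' : ∀ x, ‖deriv Φ x‖ ≤ M') :
    ∫ x, f x * deriv Φ x = -∫ x, g x * Φ x := by
  let b : ContDiffBump (0 : ℝ) := ⟨1, 2, one_pos, one_lt_two⟩
  let χ : ℝ → ℂ := fun x => (b x : ℂ)
  have hχ : ContDiff ℝ ∞ χ := Complex.ofRealCLM.contDiff.comp b.contDiff
  have hχs : HasCompactSupport χ := b.hasCompactSupport.comp_left (g := ((↑) : ℝ → ℂ)) rfl
  have hχ1 : ∀ x, ‖χ x‖ ≤ 1 := fun x => by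
    simp only [χ, Complex.norm_real, Real.norm_of_nonneg b.nonneg]
    exact b.le_one
  have hχ0 : χ =ᶠ[𝓝 0] fun _ => 1 := by
    filter_upwards [b.eventuallyEq_one] with x hx
    simp [χ, hx]
  obtain ⟨B, hB⟩ := hχs.deriv.exists_bound_of_continuous (hχ.continuous_deriv (by simp))
  have hM0 : 0 ≤ M := (norm_nonneg _).trans (hM 0)
  let ε : ℕ → ℝ := fun n => 1 / ((n : ℝ) + 1)
  have hε : ∀ n, 0 < ε n := fun n => by positivity
  have hε1 : ∀ n, ε n ≤ 1 := fun n => by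
    simp only [ε]; rw [div_le_one (by positivity)]; linarith [n.cast_nonneg (α := ℝ)]
  have hε0 : Tendsto ε atTop (𝓝 0) := tendsto_one_div_add_atTop_nhds_zero_nat
  have hlim : ∀ x, Tendsto (fun n => χ (ε n * x)) atTop (𝓝 1) := fun x => by
    have h1 : Tendsto (fun n => ε n * x) atTop (𝓝 0) := by simpa using hε0.mul_const x
    exact (tendsto_const_nhds.congr' (hχ0.symm)).comp h1
  have hc : ∀ n, ContDiff ℝ ∞ fun x => χ (ε n * x) := fun n =>
    hχ.comp (contDiff_const.mul contDiff_id)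
  have hd : ∀ n x, deriv (fun x => Φ x * χ (ε n * x)) x
      = deriv Φ x * χ (ε n * x) + Φ x * (ε n * deriv χ (ε n * x)) := fun n x => by
    rw [deriv_fun_mul (hΦ.differentiable (by simp) x) ((hc n).differentiable (by simp) x),
      deriv_comp_mul_left, Complex.real_smul]
  have key : ∀ n, ∫ x, f x * deriv (fun x => Φ x * χ (ε n * x)) x
      = -∫ x, g x * (Φ x * χ (ε n * x)) := fun n => by
    refine h _ (hΦ.mul (hc n)) (HasCompactSupport.mul_left ?_)
    exact hχs.comp_homeomorph (Homeomorph.mulLeft₀ (ε n) (hε n).ne')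
  have hΦc := hΦ.continuous
  have hΦ'c : Continuous (deriv Φ) := hΦ.continuous_deriv (by simp)
  have hχc := hχ.continuous
  have hχ'c : Continuous (deriv χ) := hχ.continuous_deriv (by simp)
  have limL : Tendsto (fun n => ∫ x, f x * deriv (fun x => Φ x * χ (ε n * x)) x) atTop
      (𝓝 (∫ x, f x * deriv Φ x)) := by
    simp only [hd]
    refine tendsto_integral_of_dominated_convergence (fun x => ‖f x‖ * (M' + M * B))
      (fun n => hf.1.mul (Continuous.aestronglyMeasurable (by fun_prop)))
      (hf.norm.mul_const _) (fun n => ae_of_all _ fun x => ?_) (ae_of_all _ fun x => ?_)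
    · rw [norm_mul]
      gcongr
      refine (norm_add_le _ _).trans (add_le_add ?_ ?_)
      · rw [norm_mul]
        exact (mul_le_of_le_one_right (norm_nonneg _) (hχ1 _)).trans (hM' x)
      · rw [norm_mul, norm_mul, Complex.norm_real, Real.norm_of_nonneg (hε n).le]
        have : ε n * ‖deriv χ (ε n * x)‖ ≤ B :=
          (mul_le_of_le_one_left (norm_nonneg _) (hε1 n)).trans (hB _)
        exact mul_le_mul (hM x) this (by have := hε n; positivity) hM0
    · refine Tendsto.const_mul _ ?_
      have h2 : Tendsto (fun n => (ε n : ℂ) * deriv χ (ε n * x)) atTop (𝓝 0) := by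
        refine squeeze_zero_norm (a := fun n => ε n * B) (fun n => ?_) ?_
        · rw [norm_mul, Complex.norm_real, Real.norm_of_nonneg (hε n).le]
          exact mul_le_mul_of_nonneg_left (hB _) (hε n).le
        · simpa using hε0.mul_const B
      simpa using ((hlim x).const_mul (deriv Φ x)).add (h2.const_mul (Φ x))
  have limR : Tendsto (fun n => -∫ x, g x * (Φ x * χ (ε n * x))) atTop
      (𝓝 (-∫ x, g x * Φ x)) := by
    refine Tendsto.neg (tendsto_integral_of_dominated_convergence (fun x => ‖g x‖ * M)
      (fun n => hg.1.mul (Continuous.aestronglyMeasurable (by fun_prop)))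
      (hg.norm.mul_const _) (fun n => ae_of_all _ fun x => ?_) (ae_of_all _ fun x => ?_))
    · rw [norm_mul, norm_mul]
      gcongr
      exact (mul_le_of_le_one_right (norm_nonneg _) (hχ1 _)).trans (hM x)
    · simpa using ((hlim x).const_mul (Φ x)).const_mul (g x)
  exact tendsto_nhds_unique (limL.congr key) limR

/-- An integrable function with integrable weak derivative `g` is almost everywhere the tail
integral of `-g`. -/
lemma IsDistribDeriv.ae_eq_neg_integral_Ioi {f g : ℝ → ℂ} (h : IsDistribDeriv f g)
    (hf : Integrable f) (hg : Integrable g) :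
    ∀ᵐ x, f x = -∫ t in Ioi x, g t := by
  have hGc : Continuous fun x => ∫ t in Ioi x, g t := by
    have : (fun x => ∫ t in Ioi x, g t) = fun x => (∫ t in Ioi 0, g t) - ∫ t in (0 : ℝ)..x, g t := by
      ext x
      rw [← intervalIntegral.integral_Ioi_sub_Ioi' hg.integrableOn hg.integrableOn, sub_sub_cancel]
    rw [this]
    exact continuous_const.sub (intervalIntegral.continuous_primitive
      (fun a b => hg.intervalIntegrable) 0)
  refine ae_eq_of_integral_contDiff_smul_eq hf.locallyIntegrable
    hGc.neg.locallyIntegrable fun ψ hψ hψs => ?_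
  have hψc := hψ.continuous
  have hψi : Integrable ψ := hψc.integrable_of_hasCompactSupport hψs
  let Ψ : ℝ → ℂ := fun x => (ψ x : ℂ)
  have hΨ : ContDiff ℝ ∞ Ψ := Complex.ofRealCLM.contDiff.comp hψ
  have hΨi : Integrable Ψ := hψi.ofReal
  let Φ : ℝ → ℂ := fun x => ∫ y in Iio x, Ψ y
  have hΦd : ∀ x, HasDerivAt Φ (Ψ x) x := fun x => by
    have : Φ = fun x => (∫ y in Iic (0 : ℝ), Ψ y) + ∫ y in (0 : ℝ)..x, Ψ y := by
      ext x
      rw [← intervalIntegral.integral_Iic_sub_Iic hΨi.integrableOn hΨi.integrableOn,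
        add_sub_cancel, integral_Iic_eq_integral_Iio]
    rw [this]
    exact (intervalIntegral.integral_hasDerivAt_right hΨi.intervalIntegrable
      (hΨ.continuous.stronglyMeasurableAtFilter _ _) hΨ.continuous.continuousAt).const_add _
  have hΦ' : deriv Φ = Ψ := funext fun x => (hΦd x).deriv
  have hΦ : ContDiff ℝ ∞ Φ :=
    contDiff_infty_iff_deriv.2 ⟨fun x => (hΦd x).differentiableAt, hΦ' ▸ hΨ⟩
  obtain ⟨B, hB⟩ := hψs.exists_bound_of_continuous hψc
  have key := h.integral_mul_deriv hf hg hΦ (M := ∫ y, ‖Ψ y‖)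
    (fun x => (norm_integral_le_integral_norm _).trans
      (setIntegral_le_integral hΨi.norm (ae_of_all _ fun _ => norm_nonneg _)))
    (M' := B) (fun x => by rw [hΦ']; simpa [Ψ] using hB x)
  have swap : ∫ x, g x * Φ x = ∫ y, Ψ y * ∫ x in Ioi y, g x := by
    have hi : Integrable (Function.uncurry fun x y : ℝ =>
        {p : ℝ × ℝ | p.2 < p.1}.indicator (fun p => g p.1 * Ψ p.2) (x, y))
        (volume.prod volume) :=
      (hg.mul_prod hΨi).indicator (measurableSet_lt measurable_snd measurable_fst)
    calc ∫ x, g x * Φ x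
        = ∫ x, ∫ y, {p : ℝ × ℝ | p.2 < p.1}.indicator (fun p => g p.1 * Ψ p.2) (x, y) := by
          congr 1 with x
          rw [← integral_const_mul, ← integral_indicator measurableSet_Iio]
          rfl
      _ = ∫ y, ∫ x, {p : ℝ × ℝ | p.2 < p.1}.indicator (fun p => g p.1 * Ψ p.2) (x, y) :=
          integral_integral_swap hi
      _ = ∫ y, Ψ y * ∫ x in Ioi y, g x := by
          congr 1 with y
          rw [← integral_const_mul, ← integral_indicator measurableSet_Ioi]
          congr 1 with x
          simp only [indicator, mem_ofPred_eq, mem_Ioi, mul_comm]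
  rw [hΦ', swap, ← integral_neg] at key
  calc ∫ x, ψ x • f x = ∫ x, f x * Ψ x := by
        congr 1 with x
        rw [Complex.real_smul, mul_comm]
    _ = _ := key
    _ = _ := by
        congr 1 with x
        rw [Complex.real_smul, mul_neg]

lemma lintegral_Ioi_exp_neg_mul {a : ℝ} (ha : 0 < a) (x : ℝ) :
    ∫⁻ t in Ioi x, ENNReal.ofReal (Real.exp (-a * t)) = ENNReal.ofReal (Real.exp (-a * x) / a) := by
  rw [← ofReal_integral_eq_lintegral_ofReal (integrableOn_exp_mul_Ioi (neg_lt_zero.2 ha) x)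
    (ae_of_all _ fun _ => (Real.exp_pos _).le), integral_exp_mul_Ioi (neg_lt_zero.2 ha), neg_div_neg_eq]

lemma lintegral_Iio_exp_mul {a : ℝ} (ha : 0 < a) (x : ℝ) :
    ∫⁻ t in Iio x, ENNReal.ofReal (Real.exp (a * t)) = ENNReal.ofReal (Real.exp (a * x) / a) := by
  rw [setLIntegral_congr Iio_ae_eq_Iic,
    ← ofReal_integral_eq_lintegral_ofReal (integrableOn_exp_mul_Iic ha x)
    (ae_of_all _ fun _ => (Real.exp_pos _).le), integral_exp_mul_Iic ha]

/-- Weighted Cauchy–Schwarz inequality for the tail integral. -/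
lemma sq_lintegral_Ioi_le {a : ℝ} (ha : 0 < a) {h : ℝ → ENNReal} (hh : AEMeasurable h) (x : ℝ) :
    (∫⁻ t in Ioi x, h t) ^ 2 ≤ ENNReal.ofReal (Real.exp (-a * x) / a) *
      ∫⁻ t in Ioi x, h t ^ 2 * ENNReal.ofReal (Real.exp (a * t)) := by
  have e : ∀ t : ℝ, h t = (h t * ENNReal.ofReal (Real.exp (a * t / 2))) *
      ENNReal.ofReal (Real.exp (-a * t / 2)) := fun t => by
    rw [mul_assoc, ← ENNReal.ofReal_mul (Real.exp_pos _).le, ← Real.exp_add]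
    ring_nf
    simp
  have e₂ : ∀ s : ℝ, ENNReal.ofReal (Real.exp (s / 2)) ^ 2 = ENNReal.ofReal (Real.exp s) :=
    fun s => by
      rw [← ENNReal.ofReal_pow (Real.exp_pos _).le, ← Real.exp_nat_mul]
      congr 2
      push_cast
      ring
  have cs := ENNReal.lintegral_mul_le_Lp_mul_Lq (volume.restrict (Ioi x))
    (p := 2) (q := 2) .two_two (f := fun t => h t * ENNReal.ofReal (Real.exp (a * t / 2)))
    (g := fun t => ENNReal.ofReal (Real.exp (-a * t / 2)))
    (hh.restrict.mul (by fun_prop)) (by fun_prop)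
  simp only [Pi.mul_apply, ← e, ENNReal.rpow_two, mul_pow, e₂, lintegral_Ioi_exp_neg_mul ha] at cs
  have sq : ∀ y : ENNReal, (y ^ (1 / 2 : ℝ)) ^ 2 = y := fun y => by
    rw [← ENNReal.rpow_two, ← ENNReal.rpow_mul]
    norm_num
  calc (∫⁻ t in Ioi x, h t) ^ 2 ≤ _ := pow_le_pow_left' cs 2
    _ = _ := by rw [mul_pow, sq, sq, mul_comm]

/-- Hardy's inequality with exponential weight. -/
lemma lintegral_sq_lintegral_Ioi_mul_exp_le {β : ℝ} (hβ : 0 < β) {h : ℝ → ENNReal}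
    (hh : AEMeasurable h) :
    ∫⁻ x, (∫⁻ t in Ioi x, h t) ^ 2 * ENNReal.ofReal (Real.exp (β * x)) ≤
      ENNReal.ofReal (4 / β ^ 2) * ∫⁻ t, h t ^ 2 * ENNReal.ofReal (Real.exp (β * t)) := by
  have ha : 0 < β / 2 := half_pos hβ
  let k : ℝ → ENNReal := fun t => h t ^ 2 * ENNReal.ofReal (Real.exp (β / 2 * t))
  have hk : AEMeasurable k := (hh.pow_const 2).mul (by fun_prop)
  let w : ℝ → ENNReal := fun x => ENNReal.ofReal (2 / β) * ENNReal.ofReal (Real.exp (β / 2 * x))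
  have hw : Measurable w := by fun_prop
  let K : ℝ → ℝ → ENNReal := fun x t =>
    {p : ℝ × ℝ | p.1 < p.2}.indicator (fun p => w p.1 * k p.2) (x, t)
  have hK : AEMeasurable (Function.uncurry K) (volume.prod volume) :=
    ((hw.comp measurable_fst).aemeasurable.mul hk.comp_snd).indicator
      (measurableSet_lt measurable_fst measurable_snd)
  calc ∫⁻ x, (∫⁻ t in Ioi x, h t) ^ 2 * ENNReal.ofReal (Real.exp (β * x))
      ≤ ∫⁻ x, ∫⁻ t, K x t := by
        refine lintegral_mono fun x => ?_
        refine (mul_le_mul_left (sq_lintegral_Ioi_le ha hh x) _).trans_eq ?_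
        have : ∫⁻ t, K x t = w x * ∫⁻ t in Ioi x, k t := by
          rw [← lintegral_const_mul'' _ hk.restrict, ← lintegral_indicator measurableSet_Ioi]
          rfl
        rw [this, mul_right_comm]
        congr 1
        simp only [w]
        rw [← ENNReal.ofReal_mul (by positivity), ← ENNReal.ofReal_mul (by positivity)]
        congr 1
        rw [div_mul_eq_mul_div, ← Real.exp_add, show -(β / 2) * x + β * x = β / 2 * x by ring]
        field_simp
    _ = ∫⁻ t, ∫⁻ x, K x t := lintegral_lintegral_swap hK
    _ = ∫⁻ t, ENNReal.ofReal (4 / β ^ 2) * (h t ^ 2 * ENNReal.ofReal (Real.exp (β * t))) := by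
        refine lintegral_congr fun t => ?_
        have : ∫⁻ x, K x t = (∫⁻ x in Iio t, w x) * k t := by
          rw [← lintegral_mul_const _ hw, ← lintegral_indicator measurableSet_Iio]
          rfl
        rw [this, lintegral_const_mul _ (by fun_prop), lintegral_Iio_exp_mul ha]
        simp only [k]
        rw [mul_left_comm, mul_left_comm (ENNReal.ofReal (4 / β ^ 2))]
        congr 1
        rw [← ENNReal.ofReal_mul (by positivity), ← ENNReal.ofReal_mul (by positivity),
          ← ENNReal.ofReal_mul (by positivity)]
        congr 1
        rw [show β * t = β / 2 * t + β / 2 * t by ring, Real.exp_add]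
        field_simp
        ring
    _ = _ := lintegral_const_mul'' _ ((hh.pow_const 2).mul (by fun_prop))

lemma IsDistribDeriv.lintegral_sq_mul_exp_le {β : ℝ} (hβ : 0 < β) {f g : ℝ → ℂ}
    (h : IsDistribDeriv f g) (hf : Integrable f) (hg : Integrable g) :
    ∫⁻ x, ‖f x‖ₑ ^ 2 * ENNReal.ofReal (Real.exp (β * x)) ≤
      ENNReal.ofReal (4 / β ^ 2) * ∫⁻ x, ‖g x‖ₑ ^ 2 * ENNReal.ofReal (Real.exp (β * x)) := by
  refine (lintegral_mono_ae ?_).trans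
    (lintegral_sq_lintegral_Ioi_mul_exp_le hβ hg.1.enorm)
  filter_upwards [h.ae_eq_neg_integral_Ioi hf hg] with x hx
  rw [hx, enorm_neg]
  gcongr
  exact enorm_integral_le_lintegral_enorm _

/-- The reflection of a weakly differentiable function. -/
lemma IsDistribDeriv.comp_neg {f g : ℝ → ℂ} (h : IsDistribDeriv f g) :
    IsDistribDeriv (fun x => f (-x)) (fun x => -g (-x)) := by
  intro φ hφ hφs
  have key := h (fun x => φ (-x)) (hφ.comp contDiff_neg)
    (hφs.comp_homeomorph (Homeomorph.neg ℝ))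
  simp only [deriv_comp_neg] at key
  rw [← integral_neg_eq_self] at key
  rw [← integral_neg_eq_self (fun x => g x * φ (-x))] at key
  simp only [neg_neg, mul_neg, integral_neg] at key
  simp only [neg_mul, integral_neg, neg_neg]
  exact neg_injective key

lemma IsDistribDeriv.lintegral_sq_mul_exp_neg_le {β : ℝ} (hβ : 0 < β) {f g : ℝ → ℂ}
    (h : IsDistribDeriv f g) (hf : Integrable f) (hg : Integrable g) :
    ∫⁻ x, ‖f x‖ₑ ^ 2 * ENNReal.ofReal (Real.exp (-(β * x))) ≤
      ENNReal.ofReal (4 / β ^ 2) * ∫⁻ x, ‖g x‖ₑ ^ 2 * ENNReal.ofReal (Real.exp (-(β * x))) := by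
  have refl : ∀ u : ℝ → ℂ, ∫⁻ x, ‖u (-x)‖ₑ ^ 2 * ENNReal.ofReal (Real.exp (β * x))
      = ∫⁻ x, ‖u x‖ₑ ^ 2 * ENNReal.ofReal (Real.exp (-(β * x))) := fun u => by
    rw [← lintegral_neg_eq_self]
    simp only [neg_neg, mul_neg]
  have key := h.comp_neg.lintegral_sq_mul_exp_le hβ hf.comp_neg hg.comp_neg.neg
  simpa only [enorm_neg, refl] using key

lemma memE.ofReal_integral {β : ℝ} {f : ℝ → ℂ} (hf : memE β f) :
    ENNReal.ofReal (∫ x, ‖f x‖ ^ 2 * Real.cosh (β * x)) =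
      ENNReal.ofReal (1 / 2) * ((∫⁻ x, ‖f x‖ₑ ^ 2 * ENNReal.ofReal (Real.exp (β * x))) +
        ∫⁻ x, ‖f x‖ₑ ^ 2 * ENNReal.ofReal (Real.exp (-(β * x)))) := by
  have hm : ∀ s : ℝ → ℝ, Measurable s →
      AEMeasurable fun x => ‖f x‖ₑ ^ 2 * ENNReal.ofReal (s x) := fun s hs =>
    (hf.1.enorm.pow_const 2).mul (by fun_prop)
  have h₁ := hm (fun x => Real.exp (β * x)) (by fun_prop)
  have h₂ := hm (fun x => Real.exp (-(β * x))) (by fun_prop)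
  rw [ofReal_integral_eq_lintegral_ofReal hf.2
    (ae_of_all _ fun x => mul_nonneg (sq_nonneg _) (Real.cosh_pos _).le),
    ← lintegral_add_left' h₁, ← lintegral_const_mul'' _ (h₁.fun_add h₂)]
  refine lintegral_congr fun x => ?_
  rw [← mul_add, ← ENNReal.ofReal_add (Real.exp_pos _).le (Real.exp_pos _).le, ← ofReal_norm,
    ← ENNReal.ofReal_pow (norm_nonneg _), ← ENNReal.ofReal_mul (by positivity),
    ← ENNReal.ofReal_mul (by positivity), Real.cosh_eq]
  congr 1
  ring

/-- Poincaré inequality: there is `C_β > 0` such that every `f ∈ ℰ`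
whose distributional derivative `f'` also lies in `ℰ` satisfies `‖f‖_ω ≤ C_β ‖f'‖_ω`. -/
theorem poincare_inequality (β : ℝ) (hβ : 0 < β) :
    ∃ C : ℝ, 0 < C ∧ ∀ f f' : ℝ → ℂ,
      memE β f → memE β f' → IsDistribDeriv f f' →
      normE β f ≤ C * normE β f' := by
  refine ⟨2 / β, by positivity, fun f f' hf hf' h => ?_⟩
  have hfi := hf.integrable hβ.ne'
  have hfi' := hf'.integrable hβ.ne'
  have h0 : 0 ≤ ∫ x, ‖f' x‖ ^ 2 * Real.cosh (β * x) :=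
    integral_nonneg fun x => mul_nonneg (sq_nonneg _) (Real.cosh_pos _).le
  have key : ∫ x, ‖f x‖ ^ 2 * Real.cosh (β * x) ≤
      4 / β ^ 2 * ∫ x, ‖f' x‖ ^ 2 * Real.cosh (β * x) := by
    rw [← ENNReal.ofReal_le_ofReal_iff (by positivity), ENNReal.ofReal_mul (by positivity),
      hf.ofReal_integral, hf'.ofReal_integral, mul_left_comm, mul_add (ENNReal.ofReal (4 / β ^ 2))]
    gcongr
    · exact h.lintegral_sq_mul_exp_le hβ hfi hfi'
    · exact h.lintegral_sq_mul_exp_neg_le hβ hfi hfi'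
  have hC : 2 / β = Real.sqrt (4 / β ^ 2) := by
    rw [show 4 / β ^ 2 = (2 / β) ^ 2 by ring, Real.sqrt_sq (by positivity)]
  rw [normE, normE, hC, ← Real.sqrt_mul (by positivity)]
  exact Real.sqrt_le_sqrt key
end

section
/- For every f ∈ C_c^∞(ℝ) one has Re ∫_ℝ (f''(x) + x f'(x) + f(x)) \overline{f(x)} ω(x) dx ≤ (1 + β²/2) ∫_ℝ |f(x)|² ω(x) dx; that is, the operator Lf = f'' + xf' + f, restricted to C_c^∞(ℝ), satisfies that L − (1 + β²/2) is dissipative with respect to the inner product of ℰ. -/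
open MeasureTheory Complex
open scoped ContDiff

/-- The integral of the derivative of a compactly supported function vanishes. -/
theorem integral_eq_zero_of_hasDerivAt_of_hasCompactSupport {g g' : ℝ → ℝ}
    (hg : ∀ x, HasDerivAt g (g' x) x) (hcont : Continuous g') (hsupp : HasCompactSupport g) :
    Integrable g' ∧ ∫ x, g' x = 0 := by
  have hderiv : deriv g = g' := funext fun x ↦ (hg x).deriv
  have hint' : Integrable g' :=
    hcont.integrable_of_hasCompactSupport (hderiv ▸ hsupp.deriv)
  have hgcont : Continuous g := continuous_iff_continuousAt.2 fun x ↦ (hg x).continuousAt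
  exact ⟨hint', integral_eq_zero_of_hasDerivAt_of_integrable hg hint'
    (hgcont.integrable_of_hasCompactSupport hsupp)⟩

/-- For every `f ∈ C_c^∞(ℝ)`,
`Re ∫ (f'' + x f' + f) * conj f * ω dx ≤ (1 + β²/2) ∫ |f|² ω dx`,
i.e. `L − (1 + β²/2)` (restricted to `C_c^∞`) is dissipative in `ℰ = L²(cosh βx)`. -/
theorem fokkerPlanck_sub_const_dissipative (β : ℝ) (hβ : 0 < β) (f : ℝ → ℂ)
    (hf : ContDiff ℝ ∞ f) (hsupp : HasCompactSupport f) :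
    (∫ x : ℝ, (deriv (deriv f) x + x * deriv f x + f x) * (starRingEnd ℂ) (f x) *
        (Real.cosh (β * x) : ℂ)).re
      ≤ (1 + β ^ 2 / 2) * ∫ x : ℝ, ‖f x‖ ^ 2 * Real.cosh (β * x) := by
  have hf₁ : ContDiff ℝ ∞ (deriv f) := hf.deriv'
  have hc₀ : Continuous f := hf.continuous
  have hc₁ : Continuous (deriv f) := hf₁.continuous
  have hc₂ : Continuous (deriv (deriv f)) := hf₁.continuous_deriv (by simp)
  have hd₀ (x : ℝ) : HasDerivAt f (deriv f x) x :=
    (hf.differentiable (by simp) x).hasDerivAt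
  have hd₁ (x : ℝ) : HasDerivAt (deriv f) (deriv (deriv f) x) x :=
    (hf₁.differentiable (by simp) x).hasDerivAt
  have hzero {x : ℝ} (hx : x ∉ tsupport f) : f x = 0 := image_eq_zero_of_notMem_tsupport hx
  have hre {h : ℝ → ℂ} {h' : ℂ} {x : ℝ} (H : HasDerivAt h h' x) :
      HasDerivAt (fun y ↦ (h y).re) h'.re x := reCLM.hasFDerivAt.comp_hasDerivAt x H
  have him {h : ℝ → ℂ} {h' : ℂ} {x : ℝ} (H : HasDerivAt h h' x) :
      HasDerivAt (fun y ↦ (h y).im) h'.im x := imCLM.hasFDerivAt.comp_hasDerivAt x H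
  have hlin (x : ℝ) : HasDerivAt (fun y : ℝ ↦ β * y) β x := by
    simpa using (hasDerivAt_id x).const_mul β
  set g : ℝ → ℝ := fun x ↦
    ((deriv f x).re * (f x).re + (deriv f x).im * (f x).im) * Real.cosh (β * x)
      + ((f x).re * (f x).re + (f x).im * (f x).im)
        * (x * Real.cosh (β * x) - β * Real.sinh (β * x)) / 2 with hg
  set g' : ℝ → ℝ := fun x ↦
    ((deriv (deriv f) x).re * (f x).re + (deriv (deriv f) x).im * (f x).im
        + ((deriv f x).re ^ 2 + (deriv f x).im ^ 2)) * Real.cosh (β * x)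
      + ((deriv f x).re * (f x).re + (deriv f x).im * (f x).im) * (x * Real.cosh (β * x))
      + ((f x).re ^ 2 + (f x).im ^ 2) * (Real.cosh (β * x) + x * (β * Real.sinh (β * x))
        - β ^ 2 * Real.cosh (β * x)) / 2 with hg'
  have hgd (x : ℝ) : HasDerivAt g (g' x) x := by
    have hcosh := (hlin x).cosh
    have hsinh := (hlin x).sinh
    have hr := hre (hd₀ x)
    have hi := him (hd₀ x)
    refine (((((hre (hd₁ x)).mul hr).add ((him (hd₁ x)).mul hi)).mul hcosh).add
      ((((hr.mul hr).add (hi.mul hi)).mul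
        (((hasDerivAt_id' x).mul hcosh).sub (hsinh.const_mul β))).div_const 2)).congr_deriv ?_
    simp only [hg', Pi.add_apply, Pi.mul_apply, Pi.sub_apply]
    ring
  obtain ⟨hgi, hg0⟩ := integral_eq_zero_of_hasDerivAt_of_hasCompactSupport hgd
    (by fun_prop) (HasCompactSupport.intro hsupp fun x hx ↦ by simp [hg, hzero hx])
  have hFi : Integrable fun x : ℝ ↦ (deriv (deriv f) x + x * deriv f x + f x) *
      (starRingEnd ℂ) (f x) * (Real.cosh (β * x) : ℂ) :=
    Continuous.integrable_of_hasCompactSupport (by fun_prop)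
      (HasCompactSupport.intro hsupp fun x hx ↦ by simp [hzero hx])
  have hNi : Integrable fun x : ℝ ↦ ‖f x‖ ^ 2 * Real.cosh (β * x) :=
    Continuous.integrable_of_hasCompactSupport (by fun_prop)
      (HasCompactSupport.intro hsupp fun x hx ↦ by simp [hzero hx])
  calc _ = ∫ x : ℝ, ((deriv (deriv f) x + x * deriv f x + f x) * (starRingEnd ℂ) (f x) *
        (Real.cosh (β * x) : ℂ)).re := (reCLM.integral_comp_comm hFi).symm
    _ ≤ ∫ x : ℝ, (g' x + (1 + β ^ 2 / 2) * (‖f x‖ ^ 2 * Real.cosh (β * x))) := by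
      refine integral_mono hFi.re (hgi.add (hNi.const_mul _)) fun x ↦ ?_
      have hcosh := Real.cosh_pos (β * x)
      have hxsinh : 0 ≤ x * (β * Real.sinh (β * x)) := by
        rcases le_total 0 x with hx | hx
        · exact mul_nonneg hx (mul_nonneg hβ.le (Real.sinh_nonneg_iff.2 (by positivity)))
        · exact mul_nonneg_of_nonpos_of_nonpos hx (mul_nonpos_of_nonneg_of_nonpos hβ.le
            (Real.sinh_nonpos_iff.2 (mul_nonpos_of_nonneg_of_nonpos hβ.le hx)))
      have h₁ : 0 ≤ ((deriv f x).re ^ 2 + (deriv f x).im ^ 2) * Real.cosh (β * x) := by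
        positivity
      have h₂ : 0 ≤ ((f x).re ^ 2 + (f x).im ^ 2) *
          (Real.cosh (β * x) + x * (β * Real.sinh (β * x))) := by positivity
      have hnorm : ‖f x‖ ^ 2 = (f x).re ^ 2 + (f x).im ^ 2 := by
        rw [Complex.sq_norm, normSq_apply]; ring
      simp only [hg', hnorm, mul_re, add_re, add_im, mul_im, conj_re, conj_im, ofReal_re,
        ofReal_im]
      linarith
    _ = _ := by
      rw [integral_add hgi (hNi.const_mul _), hg0, integral_const_mul, zero_add]
end

section
/- Let w, w₀, w₁ : ℝ → (0, ∞) be continuous functions with lim_{|x|→∞} w(x)/w₀(x) = 0. Then every sequence (f_n) of functions on ℝ such that each f_n has a distributional derivative f_n' and ∫_ℝ |f_n(x)|² w₀(x) dx + ∫_ℝ |f_n'(x)|² w₁(x) dx ≤ 1 for all n possesses a subsequence that converges in L²(ℝ, w(x)dx); in other words, the embedding of the weighted Sobolev space W^{1,2}(w₀, w₁) into L²(ℝ, w(x)dx) is compact. -/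
open MeasureTheory Complex Filter
open scoped ContDiff ENNReal

section SmoothedIndicator

/-- The mollification of the indicator function of `[a, b]` by the normalized bump `ρ`. -/
noncomputable def ContDiffBump.smoothedIndicator (ρ : ContDiffBump (0 : ℝ)) (a b x : ℝ) : ℝ :=
  ∫ t in (x - b)..(x - a), ρ.normed volume t

namespace ContDiffBump

variable (ρ : ContDiffBump (0 : ℝ)) {a b x : ℝ}

theorem hasDerivAt_smoothedIndicator (a b x : ℝ) :
    HasDerivAt (ρ.smoothedIndicator a b)
      (ρ.normed volume (x - a) - ρ.normed volume (x - b)) x := by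
  have hc : Continuous (ρ.normed volume) := ρ.continuous_normed
  have key : ∀ c : ℝ, HasDerivAt (fun y : ℝ => ∫ t in (0 : ℝ)..(y - c), ρ.normed volume t)
      (ρ.normed volume (x - c)) x := fun c => by
    have h := (hc.integral_hasStrictDerivAt 0 (x - c)).hasDerivAt
    simpa [Function.comp_def] using h.comp x ((hasDerivAt_id x).sub_const c)
  refine ((key a).sub (key b)).congr_of_eventuallyEq (Eventually.of_forall fun y => ?_)
  exact (intervalIntegral.integral_interval_sub_left (hc.intervalIntegrable _ _)
    (hc.intervalIntegrable _ _)).symm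

theorem contDiff_smoothedIndicator (a b : ℝ) : ContDiff ℝ ∞ (ρ.smoothedIndicator a b) := by
  rw [contDiff_infty_iff_deriv]
  refine ⟨fun x => (ρ.hasDerivAt_smoothedIndicator a b x).differentiableAt, ?_⟩
  have h : deriv (ρ.smoothedIndicator a b)
      = fun x => ρ.normed volume (x - a) - ρ.normed volume (x - b) :=
    funext fun x => (ρ.hasDerivAt_smoothedIndicator a b x).deriv
  have hc : ContDiff ℝ ∞ (ρ.normed volume) := ρ.contDiff_normed
  rw [h]
  exact (hc.comp (contDiff_id.sub contDiff_const)).sub (hc.comp (contDiff_id.sub contDiff_const))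

theorem normed_eq_zero_of_le_abs {t : ℝ} (ht : ρ.rOut ≤ |t|) : ρ.normed volume t = 0 := by
  rw [← Function.notMem_support, ρ.support_normed_eq, mem_ball_zero_iff, Real.norm_eq_abs]
  exact ht.not_gt

theorem smoothedIndicator_eq_zero (hab : a ≤ b) (hx : x + ρ.rOut ≤ a ∨ b + ρ.rOut ≤ x) :
    ρ.smoothedIndicator a b x = 0 := by
  refine intervalIntegral.integral_zero_ae (Eventually.of_forall fun t ht => ?_)
  rw [Set.uIoc_of_le (by linarith)] at ht
  apply ρ.normed_eq_zero_of_le_abs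
  rcases hx with hx | hx
  · exact le_trans (by linarith [ht.2]) (neg_le_abs t)
  · exact le_trans (by linarith [ht.1]) (le_abs_self t)

theorem smoothedIndicator_eq_one (ha : a + ρ.rOut ≤ x) (hb : x + ρ.rOut ≤ b) :
    ρ.smoothedIndicator a b x = 1 := by
  rw [smoothedIndicator, intervalIntegral.integral_eq_integral_of_support_subset,
    ρ.integral_normed]
  rw [ρ.support_normed_eq, Real.ball_eq_Ioo]
  exact fun t ht => ⟨by linarith [ht.1], by linarith [ht.2]⟩

theorem smoothedIndicator_nonneg (hab : a ≤ b) : 0 ≤ ρ.smoothedIndicator a b x :=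
  intervalIntegral.integral_nonneg (by linarith) fun _ _ => ρ.nonneg_normed _

theorem smoothedIndicator_le_one (hab : a ≤ b) : ρ.smoothedIndicator a b x ≤ 1 := by
  rw [smoothedIndicator, intervalIntegral.integral_of_le (by linarith),
    ← ρ.integral_normed (μ := volume)]
  exact setIntegral_le_integral ρ.integrable_normed
    (Eventually.of_forall fun _ => ρ.nonneg_normed _)

theorem hasCompactSupport_smoothedIndicator (hab : a ≤ b) :
    HasCompactSupport (ρ.smoothedIndicator a b) := by
  refine HasCompactSupport.of_support_subset_isCompact
    (isCompact_Icc (a := a - ρ.rOut) (b := b + ρ.rOut)) fun x hx => ?_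
  by_contra h
  rw [Set.mem_Icc, not_and_or, not_le, not_le] at h
  exact hx (ρ.smoothedIndicator_eq_zero hab (h.imp (fun h => by linarith) fun h => h.le))

end ContDiffBump

end SmoothedIndicator

section Convolution

open scoped Convolution

/-- A function is recovered, up to a null set, from its distributional derivative. -/
theorem IsDistribDeriv.ae_sub_eq_intervalIntegral {f f' : ℝ → ℂ} (h : IsDistribDeriv f f')
    (hf : LocallyIntegrable f volume) (hf' : LocallyIntegrable f' volume) :
    ∃ S : Set ℝ, (∀ᵐ x, x ∈ S) ∧
      ∀ a ∈ S, ∀ b ∈ S, f b - f a = ∫ x in a..b, f' x := by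
  let ρ : ℕ → ContDiffBump (0 : ℝ) := fun n =>
    ⟨1 / (2 * ((n : ℝ) + 1)), 1 / ((n : ℝ) + 1), by positivity, by
      apply one_div_lt_one_div_of_lt <;> linarith [n.cast_nonneg (α := ℝ)]⟩
  have hρ : Tendsto (fun n => (ρ n).rOut) atTop (nhds 0) := tendsto_one_div_add_atTop_nhds_zero_nat
  have hρ1 : ∀ n, (ρ n).rOut ≤ 1 := fun n => by
    change 1 / ((n : ℝ) + 1) ≤ 1
    rw [div_le_one (by positivity)]
    linarith [n.cast_nonneg (α := ℝ)]
  have hae := ContDiffBump.ae_convolution_tendsto_right_of_locallyIntegrable (μ := volume)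
    (φ := ρ) (K := 2) hρ (Eventually.of_forall fun n => le_of_eq (by
      change 1 / ((n : ℝ) + 1) = 2 * (1 / (2 * ((n : ℝ) + 1)))
      field_simp)) hf
  have hconv : ∀ n c, ((ρ n).normed volume ⋆[ContinuousLinearMap.lsmul ℝ ℝ, volume] f) c
      = ∫ x, f x * (((ρ n).normed volume (x - c) : ℝ) : ℂ) := fun n c => by
    rw [MeasureTheory.convolution_lsmul_swap]
    refine integral_congr_ae (Eventually.of_forall fun x => ?_)
    simp only [Complex.real_smul]
    rw [← (ρ n).normed_neg, neg_sub, mul_comm]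
  have hint : ∀ n c, Integrable (fun x => f x * (((ρ n).normed volume (x - c) : ℝ) : ℂ)) := by
    intro n c
    have hc : Continuous ((ρ n).normed volume) := (ρ n).continuous_normed
    have hk : HasCompactSupport ((ρ n).normed volume) := (ρ n).hasCompactSupport_normed
    have := hf.integrable_smul_left_of_hasCompactSupport
      (g := fun x => (ρ n).normed volume (x - c)) (by fun_prop)
      (hk.comp_homeomorph (Homeomorph.subRight c))
    refine this.congr (Eventually.of_forall fun x => ?_)
    simp [mul_comm]
  refine ⟨_, hae, ?_⟩
  have main : ∀ a b : ℝ, a < b →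
      Tendsto (fun n => ((ρ n).normed volume ⋆[ContinuousLinearMap.lsmul ℝ ℝ, volume] f) a)
        atTop (nhds (f a)) →
      Tendsto (fun n => ((ρ n).normed volume ⋆[ContinuousLinearMap.lsmul ℝ ℝ, volume] f) b)
        atTop (nhds (f b)) → f b - f a = ∫ x in a..b, f' x := by
    intro a b hab ha hb
    have heq : ∀ n, ((ρ n).normed volume ⋆[ContinuousLinearMap.lsmul ℝ ℝ, volume] f) b
        - ((ρ n).normed volume ⋆[ContinuousLinearMap.lsmul ℝ ℝ, volume] f) a
        = ∫ x, f' x * (((ρ n).smoothedIndicator a b x : ℝ) : ℂ) := by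
      intro n
      have hd := h (fun x => (((ρ n).smoothedIndicator a b x : ℝ) : ℂ))
        (Complex.ofRealCLM.contDiff.comp ((ρ n).contDiff_smoothedIndicator a b))
        (((ρ n).hasCompactSupport_smoothedIndicator hab.le).comp_left (g := Complex.ofReal) rfl)
      have hder : ∀ x, deriv (fun x => (((ρ n).smoothedIndicator a b x : ℝ) : ℂ)) x
          = (((ρ n).normed volume (x - a) : ℝ) : ℂ) - (((ρ n).normed volume (x - b) : ℝ) : ℂ) :=
        fun x => by
          rw [((ρ n).hasDerivAt_smoothedIndicator a b x).ofReal_comp.deriv, Complex.ofReal_sub]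
      simp only [hder, mul_sub] at hd
      rw [integral_sub (hint n a) (hint n b)] at hd
      rw [hconv, hconv, ← neg_sub, hd, neg_neg]
    refine tendsto_nhds_unique (hb.sub ha) ?_
    simp only [heq]
    rw [intervalIntegral.integral_of_le hab.le, integral_Ioc_eq_integral_Ioo,
      ← integral_indicator measurableSet_Ioo]
    refine tendsto_integral_of_dominated_convergence
      ((Set.Icc (a - 1) (b + 1)).indicator fun x => ‖f' x‖) ?_ ?_ ?_ ?_
    · intro n
      exact hf'.aestronglyMeasurable.mul
        (Complex.continuous_ofReal.comp
          ((ρ n).contDiff_smoothedIndicator a b).continuous).aestronglyMeasurable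
    · exact IntegrableOn.integrable_indicator (hf'.integrableOn_isCompact isCompact_Icc).norm
        measurableSet_Icc
    · intro n
      refine Eventually.of_forall fun x => ?_
      rw [norm_mul, Complex.norm_real, Real.norm_eq_abs,
        abs_of_nonneg ((ρ n).smoothedIndicator_nonneg hab.le)]
      by_cases hx : x ∈ Set.Icc (a - 1) (b + 1)
      · rw [Set.indicator_of_mem hx]
        exact mul_le_of_le_one_right (norm_nonneg _) ((ρ n).smoothedIndicator_le_one hab.le)
      · rw [Set.indicator_of_notMem hx, (ρ n).smoothedIndicator_eq_zero hab.le, mul_zero]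
        rw [Set.mem_Icc, not_and_or, not_le, not_le] at hx
        exact hx.imp (fun h => by linarith [hρ1 n]) fun h => by linarith [hρ1 n]
    · filter_upwards [compl_mem_ae_iff.2 (measure_singleton a),
        compl_mem_ae_iff.2 (measure_singleton b)] with x hxa hxb
      refine tendsto_const_nhds.congr' ?_
      have hsmall : ∀ c : ℝ, 0 < c → ∀ᶠ n in atTop, (ρ n).rOut < c := fun c hc =>
        hρ.eventually_lt_const hc
      rcases lt_trichotomy x a with hx | hx | hx
      · filter_upwards [hsmall (a - x) (by linarith)] with n hn
        rw [Set.indicator_of_notMem (fun h => absurd h.1 hx.not_gt),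
          (ρ n).smoothedIndicator_eq_zero hab.le (Or.inl (by linarith))]
        simp
      · exact absurd hx hxa
      · rcases lt_trichotomy x b with hx' | hx' | hx'
        · filter_upwards [hsmall (x - a) (by linarith), hsmall (b - x) (by linarith)] with n hn hn'
          rw [Set.indicator_of_mem (show x ∈ Set.Ioo a b from ⟨hx, hx'⟩),
            (ρ n).smoothedIndicator_eq_one (by linarith) (by linarith)]
          simp
        · exact absurd hx' hxb
        · filter_upwards [hsmall (x - b) (by linarith)] with n hn
          rw [Set.indicator_of_notMem (fun h => absurd h.2 hx'.not_gt),
            (ρ n).smoothedIndicator_eq_zero hab.le (Or.inr (by linarith))]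
          simp
  intro a ha b hb
  rcases lt_trichotomy a b with hab | rfl | hab
  · exact main a b hab ha hb
  · simp
  · rw [intervalIntegral.integral_symm, ← main b a hab hb ha, neg_sub]

end Convolution

section WeightedEstimates

theorem ennnorm_sq_mul_ofReal (z : ℂ) (t : ℝ) :
    (‖z‖₊ : ℝ≥0∞) ^ 2 * ENNReal.ofReal t = ENNReal.ofReal (‖z‖ ^ 2 * t) := by
  rw [ENNReal.ofReal_mul (by positivity), ENNReal.ofReal_pow (norm_nonneg _),
    ofReal_norm, enorm_eq_nnnorm]

/-- A weighted `L²` bound controls the `L¹` norm on a set where the weight is bounded below. -/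
theorem setLIntegral_enorm_le_of_weighted {u : ℝ → ℂ} {v : ℝ → ℝ} {s : Set ℝ} {m δ : ℝ}
    (hs : MeasurableSet s) (hm : 0 < m) (hδ : 0 < δ) (hv : ∀ x ∈ s, m ≤ v x)
    (hu : ∫⁻ x : ℝ, (‖u x‖₊ : ℝ≥0∞) ^ 2 * ENNReal.ofReal (v x) ≤ 1) :
    ∫⁻ x in s, ‖u x‖ₑ ≤ ENNReal.ofReal (1 / δ) * volume s + ENNReal.ofReal (δ / m) := by
  calc ∫⁻ x in s, ‖u x‖ₑ
      ≤ ∫⁻ x in s, (ENNReal.ofReal (1 / δ)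
          + ENNReal.ofReal (δ / m) * ((‖u x‖₊ : ℝ≥0∞) ^ 2 * ENNReal.ofReal (v x))) := by
        refine setLIntegral_mono_ae' hs (Eventually.of_forall fun x hx => ?_)
        have hvx := hv x hx
        rw [ennnorm_sq_mul_ofReal, ← ENNReal.ofReal_mul (by positivity),
          ← ENNReal.ofReal_add (by positivity)
            (mul_nonneg (by positivity) (mul_nonneg (by positivity) (hm.le.trans hvx))),
          ← ofReal_norm]
        apply ENNReal.ofReal_le_ofReal
        have h1 : ‖u x‖ ≤ 1 / δ + δ * ‖u x‖ ^ 2 := by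
          rw [← sub_nonneg]
          have : 1 / δ + δ * ‖u x‖ ^ 2 - ‖u x‖
              = ((δ * ‖u x‖ - 1) ^ 2 + δ * ‖u x‖) / δ := by field_simp; ring
          rw [this]
          positivity
        have h2 : δ * ‖u x‖ ^ 2 ≤ δ / m * (‖u x‖ ^ 2 * v x) := by
          rw [div_mul_eq_mul_div, le_div_iff₀ hm, mul_assoc]
          gcongr
        linarith
    _ = ENNReal.ofReal (1 / δ) * volume s + ENNReal.ofReal (δ / m)
          * ∫⁻ x in s, (‖u x‖₊ : ℝ≥0∞) ^ 2 * ENNReal.ofReal (v x) := by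
        rw [lintegral_add_left measurable_const, setLIntegral_const,
          lintegral_const_mul' _ _ ENNReal.ofReal_ne_top]
    _ ≤ _ := by
        gcongr
        exact mul_le_of_le_one_right' ((setLIntegral_le_lintegral _ _).trans hu)

theorem locallyIntegrable_of_weighted {u : ℝ → ℂ} {v : ℝ → ℝ} (hv : Continuous v)
    (hvpos : ∀ x, 0 < v x) (hmeas : AEStronglyMeasurable u volume)
    (hu : ∫⁻ x : ℝ, (‖u x‖₊ : ℝ≥0∞) ^ 2 * ENNReal.ofReal (v x) ≤ 1) :
    LocallyIntegrable u volume := by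
  rw [locallyIntegrable_iff]
  intro K hK
  obtain ⟨m, hm, hmv⟩ := hK.exists_forall_le' hv.continuousOn fun x _ => hvpos x
  refine ⟨hmeas.restrict, ?_⟩
  refine (setLIntegral_enorm_le_of_weighted hK.measurableSet hm one_pos hmv hu).trans_lt ?_
  exact ENNReal.add_lt_top.2
    ⟨ENNReal.mul_lt_top ENNReal.ofReal_lt_top hK.measure_lt_top, ENNReal.ofReal_lt_top⟩

/-- A quantitative modulus of continuity for primitives of functions bounded in weighted `L²`. -/
theorem norm_intervalIntegral_le_of_weighted {u : ℝ → ℂ} {v : ℝ → ℝ} {R m δ x y : ℝ}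
    (hm : 0 < m) (hδ : 0 < δ) (hv : ∀ x ∈ Set.Icc (-R) R, m ≤ v x)
    (hu : ∫⁻ x : ℝ, (‖u x‖₊ : ℝ≥0∞) ^ 2 * ENNReal.ofReal (v x) ≤ 1)
    (hx : x ∈ Set.Icc (-R) R) (hy : y ∈ Set.Icc (-R) R) :
    ‖∫ t in x..y, u t‖ ≤ |y - x| / δ + δ / m := by
  rw [← ENNReal.ofReal_le_ofReal_iff (by positivity), ofReal_norm,
    ← enorm_norm, intervalIntegral.norm_intervalIntegral_eq, enorm_norm]
  refine (enorm_integral_le_lintegral_enorm _).trans ?_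
  have hsub : Set.uIoc x y ⊆ Set.Icc (-R) R :=
    Set.uIoc_subset_uIcc.trans (Set.ordConnected_Icc.uIcc_subset hx hy)
  refine (setLIntegral_enorm_le_of_weighted measurableSet_uIoc hm hδ
    (fun z hz => hv z (hsub hz)) hu).trans_eq ?_
  rw [Real.volume_uIoc, ← ENNReal.ofReal_mul (by positivity),
    ← ENNReal.ofReal_add (by positivity) (by positivity), one_div,
    inv_mul_eq_div]

/-- A weighted `L²` bound yields a point of `[0, 1]` where the function is controlled. -/
theorem exists_mem_Icc_norm_sq_mul_lt {u : ℝ → ℂ} {v : ℝ → ℝ}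
    (hu : ∫⁻ x : ℝ, (‖u x‖₊ : ℝ≥0∞) ^ 2 * ENNReal.ofReal (v x) ≤ 1) :
    ∃ y ∈ Set.Icc (0 : ℝ) 1, ‖u y‖ ^ 2 * v y < 2 := by
  by_contra! h
  have : (2 : ℝ≥0∞) ≤ 1 := calc
    (2 : ℝ≥0∞) = ∫⁻ _ in Set.Icc (0 : ℝ) 1, 2 := by simp
    _ ≤ ∫⁻ x in Set.Icc (0 : ℝ) 1, (‖u x‖₊ : ℝ≥0∞) ^ 2 * ENNReal.ofReal (v x) := by
      refine setLIntegral_mono_ae' measurableSet_Icc (Eventually.of_forall fun x hx => ?_)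
      rw [ennnorm_sq_mul_ofReal]
      simpa using ENNReal.ofReal_le_ofReal (h x hx)
    _ ≤ 1 := (setLIntegral_le_lintegral _ _).trans hu
  norm_num at this

end WeightedEstimates

/-- A function with locally integrable distributional derivative agrees almost everywhere with
a primitive of that derivative. -/
theorem IsDistribDeriv.exists_ae_eq_primitive {f f' : ℝ → ℂ} (h : IsDistribDeriv f f')
    (hf : LocallyIntegrable f volume) (hf' : LocallyIntegrable f' volume) :
    ∃ F : ℝ → ℂ, f =ᵐ[volume] F ∧ ∀ x y, F y - F x = ∫ t in x..y, f' t := by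
  obtain ⟨S, hS, hSeq⟩ := h.ae_sub_eq_intervalIntegral hf hf'
  obtain ⟨a, ha⟩ := hS.exists
  have hi : ∀ x y, IntervalIntegrable f' volume x y := fun x y =>
    (hf'.integrableOn_isCompact isCompact_uIcc).intervalIntegrable
  refine ⟨fun x => f a + ∫ t in a..x, f' t, ?_, fun x y => ?_⟩
  · filter_upwards [hS] with x hx
    rw [← hSeq a ha x hx, add_sub_cancel]
  · rw [add_sub_add_left_eq_sub, intervalIntegral.integral_interval_sub_left (hi _ _) (hi _ _)]

/-- A pointwise bounded, equicontinuous sequence on `ℝ` has a pointwise convergent subsequence. -/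
theorem exists_subseq_tendsto_of_equicontinuous {F : ℕ → ℝ → ℂ}
    (hb : ∀ x, ∃ M, ∀ n, ‖F n x‖ ≤ M)
    (he : ∀ x, ∀ ε > 0, ∃ η > 0, ∀ n y, |y - x| < η → ‖F n y - F n x‖ ≤ ε) :
    ∃ φ : ℕ → ℕ, StrictMono φ ∧ ∃ g : ℝ → ℂ,
      ∀ x, Tendsto (fun n => F (φ n) x) atTop (nhds (g x)) := by
  choose M hM using hb
  obtain ⟨a, -, φ, hφ, ha⟩ := (isCompact_univ_pi fun q : ℚ =>
    isCompact_closedBall (0 : ℂ) (M q)).tendsto_subseq (x := fun n (q : ℚ) => F n q)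
      fun n q _ => by simpa using hM q n
  rw [tendsto_pi_nhds] at ha
  have hc : ∀ x, CauchySeq fun n => F (φ n) x := by
    intro x
    rw [Metric.cauchySeq_iff]
    intro ε hε
    obtain ⟨η, hη, hx⟩ := he x (ε / 4) (by positivity)
    obtain ⟨q, hq⟩ := exists_rat_btwn (show x < x + η by linarith)
    have hqx : |(q : ℝ) - x| < η := by
      rw [abs_lt]
      constructor <;> linarith [hq.1, hq.2]
    obtain ⟨N, hN⟩ := Metric.cauchySeq_iff.1 (ha q).cauchySeq (ε / 4) (by positivity)
    refine ⟨N, fun i hi j hj => ?_⟩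
    have h1 := hx (φ i) q hqx
    have h2 := hx (φ j) q hqx
    have h3 := hN i hi j hj
    simp only [Function.comp_apply] at h3
    rw [← dist_eq_norm] at h1 h2
    have h4 := dist_triangle4 (F (φ i) x) (F (φ i) q) (F (φ j) q) (F (φ j) x)
    rw [dist_comm (F (φ i) x) (F (φ i) q)] at h4
    linarith
  choose g hg using fun x => cauchySeq_tendsto_of_complete (hc x)
  exact ⟨φ, hφ, g, hg⟩

/-- Pointwise convergence with local uniform bounds and a weighted `L²` bound with respect to a
weight dominating `w` at infinity implies convergence in `L²(w)`. -/
theorem tendsto_lintegral_sq_sub_of_weighted {w w₀ : ℝ → ℝ} (hw : Continuous w)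
    (hw₀ : Continuous w₀) (hwpos : ∀ x, 0 < w x) (hw₀pos : ∀ x, 0 < w₀ x)
    (hlim : Tendsto (fun x => w x / w₀ x) (cocompact ℝ) (nhds 0))
    {F : ℕ → ℝ → ℂ} {g : ℝ → ℂ} (hF : ∀ n, AEStronglyMeasurable (F n) volume)
    (hFg : ∀ x, Tendsto (fun n => F n x) atTop (nhds (g x)))
    (hloc : ∀ K : Set ℝ, IsCompact K → ∃ M, ∀ n, ∀ x ∈ K, ‖F n x‖ ≤ M)
    (hbound : ∀ n, ∫⁻ x : ℝ, (‖F n x‖₊ : ℝ≥0∞) ^ 2 * ENNReal.ofReal (w₀ x) ≤ 1) :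
    Tendsto (fun n => ∫⁻ x : ℝ, (‖F n x - g x‖₊ : ℝ≥0∞) ^ 2 * ENNReal.ofReal (w x))
      atTop (nhds 0) := by
  have hg : AEStronglyMeasurable g volume :=
    aestronglyMeasurable_of_tendsto_ae atTop hF (Eventually.of_forall hFg)
  have hmeas : ∀ {u : ℝ → ℂ} {v : ℝ → ℝ}, AEStronglyMeasurable u volume → Continuous v →
      AEMeasurable (fun x => (‖u x‖₊ : ℝ≥0∞) ^ 2 * ENNReal.ofReal (v x)) volume :=
    fun hu hv => (hu.enorm.pow_const 2).mul hv.measurable.ennreal_ofReal.aemeasurable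
  have hgbound : ∫⁻ x : ℝ, (‖g x‖₊ : ℝ≥0∞) ^ 2 * ENNReal.ofReal (w₀ x) ≤ 1 := by
    have hpt : ∀ x, (‖g x‖₊ : ℝ≥0∞) ^ 2 * ENNReal.ofReal (w₀ x)
        = liminf (fun n => (‖F n x‖₊ : ℝ≥0∞) ^ 2 * ENNReal.ofReal (w₀ x)) atTop := fun x => by
      simp only [ennnorm_sq_mul_ofReal]
      exact (ENNReal.tendsto_ofReal (((hFg x).norm.pow 2).mul_const _)).liminf_eq.symm
    simp only [hpt]
    refine (lintegral_liminf_le' fun n => hmeas (hF n) hw₀).trans ?_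
    exact (liminf_le_liminf (Eventually.of_forall hbound)).trans_eq (liminf_const 1)
  rw [ENNReal.tendsto_nhds_zero]
  intro ε hε
  obtain ⟨c, hc, hcε⟩ := ENNReal.exists_nnreal_pos_mul_lt (a := 5) (by norm_num) hε.ne'
  have hcR : (0 : ℝ) < c := hc
  obtain ⟨K, hK, hKw⟩ := mem_cocompact.1 (hlim.eventually_lt_const hcR)
  obtain ⟨M, hM⟩ := hloc K hK
  have hMg : ∀ x ∈ K, ‖g x‖ ≤ M := fun x hx =>
    le_of_tendsto (hFg x).norm (Eventually.of_forall fun n => hM n x hx)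
  have hcpt : Tendsto
      (fun n => ∫⁻ x in K, (‖F n x - g x‖₊ : ℝ≥0∞) ^ 2 * ENNReal.ofReal (w x)) atTop (nhds 0) := by
    rw [← lintegral_zero (μ := volume.restrict K)]
    refine tendsto_lintegral_of_dominated_convergence'
      (fun x => ENNReal.ofReal ((2 * M) ^ 2 * w x)) ?_ ?_ ?_ ?_
    · exact fun n => (hmeas ((hF n).sub hg) hw).restrict
    · intro n
      filter_upwards [ae_restrict_mem hK.measurableSet] with x hx
      rw [ennnorm_sq_mul_ofReal]
      have : ‖F n x - g x‖ ≤ 2 * M :=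
        (norm_sub_le _ _).trans (by linarith [hM n x hx, hMg x hx])
      have := (hwpos x).le
      gcongr
    · have hi : IntegrableOn (fun x => (2 * M) ^ 2 * w x) K volume :=
        (by fun_prop : Continuous fun x => (2 * M) ^ 2 * w x).continuousOn.integrableOn_compact hK
      exact hi.lintegral_lt_top.ne
    · refine Eventually.of_forall fun x => ?_
      simp only [ennnorm_sq_mul_ofReal]
      have h0 : Tendsto (fun n => ‖F n x - g x‖ ^ 2 * w x) atTop (nhds 0) := by
        simpa using (((hFg x).sub_const (g x)).norm.pow 2).mul_const (w x)
      simpa using ENNReal.tendsto_ofReal h0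
  have htail : ∀ n, ∫⁻ x in Kᶜ, (‖F n x - g x‖₊ : ℝ≥0∞) ^ 2 * ENNReal.ofReal (w x) ≤ 4 * c := by
    intro n
    calc ∫⁻ x in Kᶜ, (‖F n x - g x‖₊ : ℝ≥0∞) ^ 2 * ENNReal.ofReal (w x)
        ≤ ∫⁻ x in Kᶜ, 2 * c * ((‖F n x‖₊ : ℝ≥0∞) ^ 2 * ENNReal.ofReal (w₀ x)
            + (‖g x‖₊ : ℝ≥0∞) ^ 2 * ENNReal.ofReal (w₀ x)) := by
          refine setLIntegral_mono_ae' hK.measurableSet.compl (Eventually.of_forall fun x hx => ?_)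
          have hwx : w x ≤ c * w₀ x := ((div_lt_iff₀ (hw₀pos x)).1 (hKw hx)).le
          have h0 := (hw₀pos x).le
          have h2 : (2 * c : ℝ≥0∞) = ENNReal.ofReal (2 * c) := by
            rw [ENNReal.ofReal_mul zero_le_two, ENNReal.ofReal_coe_nnreal, ENNReal.ofReal_ofNat]
          rw [ennnorm_sq_mul_ofReal, ennnorm_sq_mul_ofReal, ennnorm_sq_mul_ofReal, h2,
            ← ENNReal.ofReal_add (by positivity) (by positivity),
            ← ENNReal.ofReal_mul (by positivity)]
          apply ENNReal.ofReal_le_ofReal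
          calc ‖F n x - g x‖ ^ 2 * w x
              ≤ (‖F n x‖ + ‖g x‖) ^ 2 * (c * w₀ x) := by
                gcongr
                · exact (hwpos x).le
                · exact norm_sub_le (F n x) (g x)
            _ ≤ (2 * (‖F n x‖ ^ 2 + ‖g x‖ ^ 2)) * (c * w₀ x) := by
                gcongr
                exact add_sq_le
            _ = _ := by ring
      _ ≤ ∫⁻ x, 2 * c * ((‖F n x‖₊ : ℝ≥0∞) ^ 2 * ENNReal.ofReal (w₀ x)
            + (‖g x‖₊ : ℝ≥0∞) ^ 2 * ENNReal.ofReal (w₀ x)) := setLIntegral_le_lintegral _ _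
      _ = 2 * c * ((∫⁻ x, (‖F n x‖₊ : ℝ≥0∞) ^ 2 * ENNReal.ofReal (w₀ x))
            + ∫⁻ x, (‖g x‖₊ : ℝ≥0∞) ^ 2 * ENNReal.ofReal (w₀ x)) := by
          rw [lintegral_const_mul' _ _ (by finiteness), lintegral_add_left' (hmeas (hF n) hw₀)]
      _ ≤ 2 * c * (1 + 1) := by gcongr; exact hbound n
      _ = 4 * c := by ring
  filter_upwards [ENNReal.tendsto_nhds_zero.1 hcpt c (by exact_mod_cast hc)] with n hn
  rw [← lintegral_add_compl _ hK.measurableSet]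
  calc _ ≤ (c : ℝ≥0∞) + 4 * c := add_le_add hn (htail n)
    _ = c * 5 := by ring
    _ ≤ ε := by simpa [mul_comm] using hcε.le

/-- compact embedding `W^{1,2}(w₀,w₁) ↪↪ L²(w)`:
if `w/w₀ → 0` at infinity, then every sequence bounded in the weighted Sobolev space
`W^{1,2}(w₀,w₁)` has a subsequence converging in `L²(ℝ, w dx)`. -/
theorem compact_embedding_weighted_sobolev
    (w w₀ w₁ : ℝ → ℝ) (hw : Continuous w) (hw₀ : Continuous w₀) (hw₁ : Continuous w₁)
    (hwpos : ∀ x, 0 < w x) (hw₀pos : ∀ x, 0 < w₀ x) (hw₁pos : ∀ x, 0 < w₁ x)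
    (hlim : Tendsto (fun x => w x / w₀ x) (cocompact ℝ) (nhds 0))
    (f f' : ℕ → ℝ → ℂ)
    (hmeas : ∀ n, AEStronglyMeasurable (f n) volume)
    (hmeas' : ∀ n, AEStronglyMeasurable (f' n) volume)
    (hderiv : ∀ n, IsDistribDeriv (f n) (f' n))
    (hbound : ∀ n,
      (∫⁻ x : ℝ, (‖f n x‖₊ : ℝ≥0∞) ^ 2 * ENNReal.ofReal (w₀ x))
        + (∫⁻ x : ℝ, (‖f' n x‖₊ : ℝ≥0∞) ^ 2 * ENNReal.ofReal (w₁ x)) ≤ 1) :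
    ∃ φ : ℕ → ℕ, StrictMono φ ∧ ∃ g : ℝ → ℂ, AEStronglyMeasurable g volume ∧
      Tendsto (fun n => ∫⁻ x : ℝ, (‖f (φ n) x - g x‖₊ : ℝ≥0∞) ^ 2 * ENNReal.ofReal (w x))
        atTop (nhds 0) := by
  have hb₀ : ∀ n, ∫⁻ x : ℝ, (‖f n x‖₊ : ℝ≥0∞) ^ 2 * ENNReal.ofReal (w₀ x) ≤ 1 :=
    fun n => le_self_add.trans (hbound n)
  have hb₁ : ∀ n, ∫⁻ x : ℝ, (‖f' n x‖₊ : ℝ≥0∞) ^ 2 * ENNReal.ofReal (w₁ x) ≤ 1 :=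
    fun n => le_add_self.trans (hbound n)
  choose F hfF hF using fun n => (hderiv n).exists_ae_eq_primitive
    (locallyIntegrable_of_weighted hw₀ hw₀pos (hmeas n) (hb₀ n))
    (locallyIntegrable_of_weighted hw₁ hw₁pos (hmeas' n) (hb₁ n))
  have hFb₀ : ∀ n, ∫⁻ x : ℝ, (‖F n x‖₊ : ℝ≥0∞) ^ 2 * ENNReal.ofReal (w₀ x) ≤ 1 := fun n => by
    refine le_of_eq_of_le (lintegral_congr_ae ?_) (hb₀ n)
    filter_upwards [hfF n] with x hx
    rw [hx]
  have hmod : ∀ R : ℝ, ∃ m > 0, ∀ n, ∀ δ > 0, ∀ x ∈ Set.Icc (-R) R, ∀ y ∈ Set.Icc (-R) R,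
      ‖F n y - F n x‖ ≤ |y - x| / δ + δ / m := by
    intro R
    obtain ⟨m, hm, hmw⟩ := (isCompact_Icc (a := -R) (b := R)).exists_forall_le' hw₁.continuousOn
      fun x _ => hw₁pos x
    refine ⟨m, hm, fun n δ hδ x hx y hy => ?_⟩
    rw [hF]
    exact norm_intervalIntegral_le_of_weighted hm hδ hmw (hb₁ n) hx hy
  have hloc : ∀ K : Set ℝ, IsCompact K → ∃ M, ∀ n, ∀ x ∈ K, ‖F n x‖ ≤ M := by
    intro K hK
    obtain ⟨R, hR, hKR⟩ := hK.isBounded.subset_closedBall_lt 1 0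
    rw [Real.closedBall_eq_Icc, zero_sub, zero_add] at hKR
    obtain ⟨m, hm, hFm⟩ := hmod R
    obtain ⟨m₀, hm₀, hmw₀⟩ := (isCompact_Icc (a := (0 : ℝ)) (b := 1)).exists_forall_le'
      hw₀.continuousOn fun x _ => hw₀pos x
    refine ⟨(1 + 2 / m₀) + (2 * R + 1 / m), fun n x hx => ?_⟩
    obtain ⟨y, hy, hFy⟩ := exists_mem_Icc_norm_sq_mul_lt (hFb₀ n)
    have hxR := hKR hx
    have h1 := hFm n 1 one_pos y ⟨by linarith [hy.1], by linarith [hy.2]⟩ x hxR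
    have h2 : |x - y| ≤ 2 * R := abs_le.2
      ⟨by linarith [hxR.1, hy.2], by linarith [hxR.2, hy.1]⟩
    have h3 : ‖F n y‖ ^ 2 ≤ 2 / m₀ := by
      rw [le_div_iff₀ hm₀]
      exact (mul_le_mul_of_nonneg_left (hmw₀ y hy) (by positivity)).trans hFy.le
    have h4 : ‖F n y‖ ≤ 1 + ‖F n y‖ ^ 2 := by nlinarith [sq_nonneg (‖F n y‖ - 1)]
    have h5 := norm_le_norm_add_norm_sub' (F n x) (F n y)
    rw [div_one] at h1
    linarith
  have hequi : ∀ x, ∀ ε > 0, ∃ η > 0, ∀ n y, |y - x| < η → ‖F n y - F n x‖ ≤ ε := by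
    intro x ε hε
    obtain ⟨m, hm, hFm⟩ := hmod (|x| + 1)
    have hδ : 0 < ε * m / 2 := by positivity
    refine ⟨min 1 (ε / 2 * (ε * m / 2)), by positivity, fun n y hy => ?_⟩
    have hy1 := abs_lt.1 (hy.trans_le (min_le_left _ _))
    have hy2 := hy.le.trans (min_le_right _ _)
    have h := hFm n _ hδ x ⟨by linarith [neg_abs_le x], by linarith [le_abs_self x]⟩ y
      ⟨by linarith [neg_abs_le x], by linarith [le_abs_self x]⟩
    rw [← div_le_iff₀ hδ] at hy2
    have : ε * m / 2 / m = ε / 2 := by field_simp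
    linarith
  obtain ⟨φ, hφ, g, hg⟩ := exists_subseq_tendsto_of_equicontinuous
    (fun x => (hloc {x} isCompact_singleton).imp fun M hM n => hM n x rfl) hequi
  have hFmeas : ∀ n, AEStronglyMeasurable (F n) volume := fun n => (hmeas n).congr (hfF n)
  refine ⟨φ, hφ, g, aestronglyMeasurable_of_tendsto_ae atTop (fun n => hFmeas (φ n))
    (Eventually.of_forall hg), ?_⟩
  refine (tendsto_lintegral_sq_sub_of_weighted hw hw₀ hwpos hw₀pos hlim
    (fun n => hFmeas (φ n)) hg (fun K hK => (hloc K hK).imp fun M hM n => hM (φ n))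
    fun n => hFb₀ (φ n)).congr fun n => lintegral_congr_ae ?_
  filter_upwards [hfF (φ n)] with x hx
  rw [hx]
end

section
/- Let ζ ∈ ℂ. There exists a nonzero f ∈ ℰ satisfying the eigenvalue equation 𝔏f = ζf in the distributional sense if and only if ζ = −k for some k ∈ ℕ₀. Moreover, in that case every such f is a scalar multiple of μ_k, where μ_k(x) = (2π)^{−1/2} (d/dx)^k e^{−x²/2}; in particular each eigenspace is one-dimensional. -/
open MeasureTheory Complex
open scoped ContDiff

/-- `𝔏 f = g` in the distributional sense, i.e.
`∫ f (φ'' − x φ') = ∫ g φ` for all test functions `φ`. -/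
def FPeq (f g : ℝ → ℂ) : Prop :=
  ∀ φ : ℝ → ℂ, ContDiff ℝ ∞ φ → HasCompactSupport φ →
    ∫ x : ℝ, f x * (deriv (deriv φ) x - x * deriv φ x) = ∫ x : ℝ, g x * φ x

/-- The eigenfunction `μ_k(x) = (2π)^{-1/2} (d/dx)^k e^{-x²/2}`. -/
noncomputable def muk (k : ℕ) (x : ℝ) : ℂ :=
  (Real.sqrt (2 * Real.pi) : ℂ)⁻¹ *
    iteratedDeriv k (fun y : ℝ => Complex.exp (-(y : ℂ) ^ 2 / 2)) x

/-- Two finite measures on `ℝ` with some exponential moments and equal moments coincide. -/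
theorem Measure.ext_of_moments {μ ν : Measure ℝ} [IsFiniteMeasure μ] [IsFiniteMeasure ν]
    {a : ℝ} (ha : 0 < a)
    (hμ₁ : Integrable (fun x => Real.exp (a * x)) μ)
    (hμ₂ : Integrable (fun x => Real.exp (-a * x)) μ)
    (hν₁ : Integrable (fun x => Real.exp (a * x)) ν)
    (hν₂ : Integrable (fun x => Real.exp (-a * x)) ν)
    (h : ∀ n : ℕ, ∫ x, x ^ n ∂μ = ∫ x, x ^ n ∂ν) : μ = ν := by
  have key : ∀ ρ : Measure ℝ, Integrable (fun x => Real.exp (a * x)) ρ →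
      Integrable (fun x => Real.exp (-a * x)) ρ →
      Set.Ioo (-a) a ⊆ interior (ProbabilityTheory.integrableExpSet id ρ) := by
    intro ρ h₁ h₂
    rw [isOpen_Ioo.subset_interior_iff]
    intro t ht
    exact ProbabilityTheory.convex_integrableExpSet.ordConnected.out
      (x := -a) (by simpa [ProbabilityTheory.integrableExpSet] using h₂)
      (y := a) (by simpa [ProbabilityTheory.integrableExpSet] using h₁)
      ⟨ht.1.le, ht.2.le⟩
  have hμ := key μ hμ₁ hμ₂
  have hν := key ν hν₁ hν₂
  set S : Set ℂ := Complex.re ⁻¹' Set.Ioo (-a) a with hS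
  have aμ : AnalyticOnNhd ℂ (ProbabilityTheory.complexMGF id μ) S :=
    fun z hz => ProbabilityTheory.analyticAt_complexMGF (hμ hz)
  have aν : AnalyticOnNhd ℂ (ProbabilityTheory.complexMGF id ν) S :=
    fun z hz => ProbabilityTheory.analyticAt_complexMGF (hν hz)
  have h0 : (0 : ℂ) ∈ S := by simp [hS, ha]
  have hpre : IsPreconnected S :=
    ((convex_Ioo (-a) a).linear_preimage Complex.reLm).isPreconnected
  have hloc : ProbabilityTheory.complexMGF id μ =ᶠ[nhds 0]
      ProbabilityTheory.complexMGF id ν := by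
    have p₁ := (aμ 0 h0).hasFPowerSeriesAt
    have p₂ := (aν 0 h0).hasFPowerSeriesAt
    have hcoef : ∀ n, iteratedDeriv n (ProbabilityTheory.complexMGF id μ) 0 =
        iteratedDeriv n (ProbabilityTheory.complexMGF id ν) 0 := by
      intro n
      rw [ProbabilityTheory.iteratedDeriv_complexMGF (hμ h0),
        ProbabilityTheory.iteratedDeriv_complexMGF (hν h0)]
      have := congrArg (fun r : ℝ => (r : ℂ)) (h n)
      simp only [← integral_complex_ofReal] at this
      simpa using this
    simp only [hcoef] at p₁
    have := (p₁.sub p₂)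
    rw [sub_self] at this
    filter_upwards [this.eventually_eq_zero] with z hz
    exact sub_eq_zero.mp hz
  have heq := aμ.eqOn_of_preconnected_of_eventuallyEq aν hpre h0 hloc
  refine Measure.ext_of_charFun (funext fun t => ?_)
  rw [← ProbabilityTheory.complexMGF_id_mul_I, ← ProbabilityTheory.complexMGF_id_mul_I]
  exact heq (by simp [hS, ha])

/-- A real function with exponential decay all of whose moments vanish is zero. -/
theorem ae_eq_zero_of_moments_real {u : ℝ → ℝ} {a : ℝ} (ha : 0 < a)
    (hm : AEStronglyMeasurable u volume)
    (hu : Integrable (fun x => Real.exp (a * |x|) * |u x|))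
    (h : ∀ n : ℕ, ∫ x, x ^ n * u x = 0)
    (hn : ∀ n : ℕ, Integrable fun x : ℝ => x ^ n * u x) : u =ᵐ[volume] 0 := by
  have hui : Integrable u := by simpa using hn 0
  have hm' : AEStronglyMeasurable (fun x => -u x) volume := hm.neg
  have expint : ∀ v : ℝ → ℝ, AEStronglyMeasurable v volume → (∀ x, |v x| = |u x|) → ∀ b : ℝ,
      |b| = a → Integrable (fun x => Real.exp (b * x))
        (volume.withDensity fun x => ENNReal.ofReal (v x)) := by
    intro v hv hvu b hb
    rw [integrable_withDensity_iff_integrable_smul₀' hv.aemeasurable.ennreal_ofReal (by simp)]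
    refine hu.mono' ?_ (.of_forall fun x => ?_)
    · exact hv.aemeasurable.ennreal_ofReal.ennreal_toReal.aestronglyMeasurable.smul
        (g := fun x => Real.exp (b * x)) (by fun_prop)
    · rw [smul_eq_mul, mul_comm, norm_mul, Real.norm_eq_abs, Real.norm_eq_abs, Real.abs_exp]
      refine mul_le_mul (Real.exp_le_exp.mpr ?_) ?_ (abs_nonneg _) (Real.exp_pos _).le
      · calc b * x ≤ |b * x| := le_abs_self _
          _ = a * |x| := by rw [abs_mul, hb]
      · rw [ENNReal.toReal_ofReal', ← hvu]
        rw [abs_of_nonneg (le_max_right _ _)]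
        exact max_le (le_abs_self _) (abs_nonneg _)
  have : IsFiniteMeasure (volume.withDensity fun x => ENNReal.ofReal (u x)) :=
    isFiniteMeasure_withDensity_ofReal hui.2
  have : IsFiniteMeasure (volume.withDensity fun x => ENNReal.ofReal (-u x)) :=
    isFiniteMeasure_withDensity_ofReal hui.neg.2
  have heq := Measure.ext_of_moments (μ := volume.withDensity fun x => ENNReal.ofReal (u x))
    (ν := volume.withDensity fun x => ENNReal.ofReal (-u x)) ha
    (expint _ hm (fun _ => rfl) a (abs_of_pos ha))
    (expint _ hm (fun _ => rfl) (-a) (by rw [abs_neg, abs_of_pos ha]))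
    (expint _ hm' (fun x => abs_neg _) a (abs_of_pos ha))
    (expint _ hm' (fun x => abs_neg _) (-a) (by rw [abs_neg, abs_of_pos ha])) (by
      intro n
      rw [integral_withDensity_eq_integral_toReal_smul₀ hm.aemeasurable.ennreal_ofReal (by simp),
        integral_withDensity_eq_integral_toReal_smul₀ hm'.aemeasurable.ennreal_ofReal (by simp),
        ← sub_eq_zero, ← integral_sub, ← h n]
      · congr 1 with x
        simp only [ENNReal.toReal_ofReal', smul_eq_mul]
        rcases le_total 0 (u x) with h0 | h0
        · rw [max_eq_left h0, max_eq_right (by linarith)]; ring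
        · rw [max_eq_right h0, max_eq_left (by linarith)]; ring
      · refine (hn n).mono ?_ (.of_forall fun x => ?_)
        · exact AEStronglyMeasurable.smul
            hm.aemeasurable.ennreal_ofReal.ennreal_toReal.aestronglyMeasurable (by fun_prop)
        · rw [smul_eq_mul, mul_comm, norm_mul, norm_mul]
          refine mul_le_mul_of_nonneg_left ?_ (norm_nonneg _)
          rw [ENNReal.toReal_ofReal', Real.norm_eq_abs, Real.norm_eq_abs,
            abs_of_nonneg (le_max_right _ _)]
          exact max_le (le_abs_self _) (abs_nonneg _)
      · refine (hn n).mono ?_ (.of_forall fun x => ?_)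
        · exact AEStronglyMeasurable.smul
            hm'.aemeasurable.ennreal_ofReal.ennreal_toReal.aestronglyMeasurable (by fun_prop)
        · rw [smul_eq_mul, mul_comm, norm_mul, norm_mul]
          refine mul_le_mul_of_nonneg_left ?_ (norm_nonneg _)
          rw [ENNReal.toReal_ofReal', Real.norm_eq_abs, Real.norm_eq_abs,
            abs_of_nonneg (le_max_right _ _)]
          exact max_le (neg_le_abs _) (abs_nonneg _))
  rw [withDensity_eq_iff_of_sigmaFinite hm.aemeasurable.ennreal_ofReal
    hm'.aemeasurable.ennreal_ofReal] at heq
  filter_upwards [heq] with x hx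
  rcases le_total 0 (u x) with h0 | h0
  · rw [ENNReal.ofReal_of_nonpos (by linarith : -u x ≤ 0), ENNReal.ofReal_eq_zero] at hx
    exact le_antisymm hx h0
  · rw [ENNReal.ofReal_of_nonpos h0, eq_comm, ENNReal.ofReal_eq_zero] at hx
    simp only [Pi.zero_apply]
    linarith

/-- Exponential integrability of order `a`. -/
def HasExpMoment (a : ℝ) (h : ℝ → ℂ) : Prop :=
  AEStronglyMeasurable h volume ∧ Integrable fun x : ℝ => Real.exp (a * |x|) * ‖h x‖

theorem HasExpMoment.integrable_mul {a : ℝ} (ha : 0 < a) {h : ℝ → ℂ} (hh : HasExpMoment a h)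
    {p : ℝ → ℂ} (hp : AEStronglyMeasurable p volume) {C : ℝ} (n : ℕ)
    (hpC : ∀ x, ‖p x‖ ≤ C * |x| ^ n) : Integrable fun x : ℝ => h x * p x := by
  refine (hh.2.const_mul (|C| * (n.factorial / a ^ n))).mono' (hh.1.mul hp)
    (.of_forall fun x => ?_)
  have h1 := Real.pow_div_factorial_le_exp (a * |x|) (by positivity) n
  have h2 : |x| ^ n ≤ (n.factorial / a ^ n) * Real.exp (a * |x|) := by
    rw [div_le_iff₀ (by positivity), mul_pow] at h1
    rw [div_mul_eq_mul_div, le_div_iff₀ (by positivity)]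
    linarith
  calc ‖h x * p x‖ = ‖p x‖ * ‖h x‖ := by rw [norm_mul, mul_comm]
    _ ≤ (|C| * ((n.factorial / a ^ n) * Real.exp (a * |x|))) * ‖h x‖ := by
        gcongr
        exact (hpC x).trans (mul_le_mul (le_abs_self _) h2 (by positivity) (abs_nonneg _))
    _ = _ := by ring

theorem HasExpMoment.integrable_mul_pow {a : ℝ} (ha : 0 < a) {h : ℝ → ℂ}
    (hh : HasExpMoment a h) (n : ℕ) : Integrable fun x : ℝ => h x * (x : ℂ) ^ n :=
  hh.integrable_mul ha (by fun_prop) (C := 1) n fun x => by simp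

theorem HasExpMoment.sub_const_mul {a : ℝ} {f g : ℝ → ℂ} (hf : HasExpMoment a f)
    (hg : HasExpMoment a g) (c : ℂ) : HasExpMoment a fun x => f x - c * g x := by
  have hm : AEStronglyMeasurable (fun x => f x - c * g x) volume :=
    hf.1.sub (hg.1.const_mul c)
  refine ⟨hm, (hf.2.add (hg.2.const_mul ‖c‖)).mono' ?_ (.of_forall fun x => ?_)⟩
  · exact AEStronglyMeasurable.mul (by fun_prop) hm.norm
  · rw [norm_mul, norm_norm, Real.norm_eq_abs, Real.abs_exp, Pi.add_apply]
    have : ‖f x - c * g x‖ ≤ ‖f x‖ + ‖c‖ * ‖g x‖ := by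
      rw [← norm_mul]; exact norm_sub_le _ _
    nlinarith [Real.exp_pos (a * |x|)]

/-- A function with exponential decay is determined by its moments. -/
theorem HasExpMoment.ae_eq_zero {a : ℝ} (ha : 0 < a) {h : ℝ → ℂ} (hh : HasExpMoment a h)
    (hm : ∀ n : ℕ, ∫ x : ℝ, h x * (x : ℂ) ^ n = 0) : h =ᵐ[volume] 0 := by
  have hre : (fun x => (h x).re) =ᵐ[volume] 0 := by
    have e : ∀ (n : ℕ) (x : ℝ), (h x * (x : ℂ) ^ n).re = x ^ n * (h x).re := fun n x => by
      rw [← ofReal_pow, re_mul_ofReal, mul_comm]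
    refine ae_eq_zero_of_moments_real ha (Complex.continuous_re.comp_aestronglyMeasurable hh.1)
      (hh.2.mono' ?_ (.of_forall fun x => ?_)) (fun n => ?_) (fun n => ?_)
    · exact AEStronglyMeasurable.mul (by fun_prop)
        (Complex.continuous_re.comp_aestronglyMeasurable hh.1).norm
    · rw [norm_mul, Real.norm_eq_abs, Real.norm_eq_abs, Real.abs_exp, abs_abs]
      gcongr
      exact abs_re_le_norm _
    · have := integral_re (𝕜 := ℂ) (hh.integrable_mul_pow ha n)
      simpa only [RCLike.re_to_complex, e, hm n, zero_re] using this
    · simpa only [RCLike.re_to_complex, e] using (hh.integrable_mul_pow ha n).re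
  have him : (fun x => (h x).im) =ᵐ[volume] 0 := by
    have e : ∀ (n : ℕ) (x : ℝ), (h x * (x : ℂ) ^ n).im = x ^ n * (h x).im := fun n x => by
      rw [← ofReal_pow, im_mul_ofReal, mul_comm]
    refine ae_eq_zero_of_moments_real ha (Complex.continuous_im.comp_aestronglyMeasurable hh.1)
      (hh.2.mono' ?_ (.of_forall fun x => ?_)) (fun n => ?_) (fun n => ?_)
    · exact AEStronglyMeasurable.mul (by fun_prop)
        (Complex.continuous_im.comp_aestronglyMeasurable hh.1).norm
    · rw [norm_mul, Real.norm_eq_abs, Real.norm_eq_abs, Real.abs_exp, abs_abs]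
      gcongr
      exact abs_im_le_norm _
    · have := integral_im (𝕜 := ℂ) (hh.integrable_mul_pow ha n)
      simpa only [RCLike.im_to_complex, e, hm n, zero_im] using this
    · simpa only [RCLike.im_to_complex, e] using (hh.integrable_mul_pow ha n).im
  filter_upwards [hre, him] with x h1 h2
  exact Complex.ext h1 h2

theorem integrable_exp_mul_abs {b : ℝ} (hb : b < 0) :
    Integrable fun x : ℝ => Real.exp (b * |x|) := by
  rw [← integrableOn_univ, ← Set.Iic_union_Ioi (a := (0 : ℝ))]
  refine IntegrableOn.union ?_ ?_
  · refine (integrableOn_exp_mul_Iic (neg_pos.mpr hb) 0).congr_fun (fun x hx => ?_)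
      measurableSet_Iic
    simp only [abs_of_nonpos (Set.mem_Iic.mp hx), neg_mul, mul_neg]
  · refine (integrableOn_exp_mul_Ioi hb 0).congr_fun (fun x hx => ?_) measurableSet_Ioi
    simp only [abs_of_pos (Set.mem_Ioi.mp hx)]

theorem memE.hasExpMoment {β : ℝ} (hβ : 0 < β) {f : ℝ → ℂ} (hf : memE β f) :
    HasExpMoment (β / 4) f := by
  refine ⟨hf.1, ?_⟩
  have hexp : Integrable fun x : ℝ => Real.exp (-(β / 2) * |x|) :=
    integrable_exp_mul_abs (by linarith)
  refine ((hf.2.const_mul 2).add hexp).mono' ?_ (.of_forall fun x => ?_)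
  · exact AEStronglyMeasurable.mul (by fun_prop) hf.1.norm
  · rw [norm_mul, norm_norm, Real.norm_eq_abs, Real.abs_exp, Pi.add_apply]
    have h1 : Real.exp (β * |x|) ≤ 2 * Real.cosh (β * x) := by
      rw [← Real.cosh_abs (β * x), abs_mul, abs_of_pos hβ, Real.cosh_eq]
      have := Real.exp_pos (-(β * |x|))
      linarith
    set E := Real.exp (β / 4 * |x|) with hE
    have h2 : Real.exp (β * |x|) = E ^ 4 := by
      rw [hE, ← Real.exp_nat_mul]; congr 1; push_cast; ring
    have h3 : Real.exp (-(β / 2) * |x|) = (E⁻¹) ^ 2 := by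
      rw [hE, ← Real.exp_neg, ← Real.exp_nat_mul]; congr 1; push_cast; ring
    have hE0 : 0 < E := Real.exp_pos _
    have h4 : E * ‖f x‖ ≤ ‖f x‖ ^ 2 * E ^ 4 + (E⁻¹) ^ 2 := by
      have : E * ‖f x‖ = (‖f x‖ * E ^ 2) * E⁻¹ := by field_simp
      rw [this]
      nlinarith [sq_nonneg (‖f x‖ * E ^ 2 - E⁻¹), sq_nonneg (‖f x‖ * E ^ 2 ), sq_nonneg (E⁻¹)]
    rw [h3]
    have h5 := mul_le_mul_of_nonneg_left h1 (sq_nonneg ‖f x‖)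
    rw [h2] at h5
    linarith
theorem HasExpMoment.integrable_mul_pow_mul {a : ℝ} (ha : 0 < a) {f : ℝ → ℂ}
    (hf : HasExpMoment a f) {η : ℝ → ℂ} (hη : Continuous η) {C : ℝ} (hC : ∀ x, ‖η x‖ ≤ C)
    (n : ℕ) (ε : ℝ) : Integrable fun x : ℝ => f x * ((x : ℂ) ^ n * η (ε * x)) := by
  refine hf.integrable_mul ha (by fun_prop) (C := C) n fun x => ?_
  rw [norm_mul, norm_pow, norm_real, Real.norm_eq_abs, mul_comm]
  gcongr
  exact hC _

/-- Moments of a function truncated at scale `1 / ε` converge as `ε → 0`. -/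
theorem HasExpMoment.tendsto_truncated_moment {a : ℝ} (ha : 0 < a) {f : ℝ → ℂ}
    (hf : HasExpMoment a f) {η : ℝ → ℂ} (hη : Continuous η) {C : ℝ} (hC : ∀ x, ‖η x‖ ≤ C)
    (n : ℕ) {ε : ℕ → ℝ} (hε : Filter.Tendsto ε Filter.atTop (nhds 0)) :
    Filter.Tendsto (fun N => ∫ x : ℝ, f x * ((x : ℂ) ^ n * η (ε N * x))) Filter.atTop
      (nhds ((∫ x : ℝ, f x * (x : ℂ) ^ n) * η 0)) := by
  rw [← integral_mul_const]
  refine tendsto_integral_of_dominated_convergence (fun x => C * ‖f x * (x : ℂ) ^ n‖)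
    (fun N => (hf.integrable_mul_pow_mul ha hη hC n (ε N)).1)
    ((hf.integrable_mul_pow ha n).norm.const_mul C) (fun N => .of_forall fun x => ?_)
    (.of_forall fun x => ?_)
  · rw [← mul_assoc, norm_mul, mul_comm]
    gcongr
    exact hC _
  · have h0 : Filter.Tendsto (fun N => ε N * x) Filter.atTop (nhds 0) := by
      simpa using hε.mul_const x
    simpa only [mul_assoc, Function.comp_apply] using
      ((hη.tendsto 0).comp h0).const_mul (f x * (x : ℂ) ^ n)

theorem exists_cutoff : ∃ χ : ℝ → ℂ, ContDiff ℝ ∞ χ ∧ HasCompactSupport χ ∧ χ 0 = 1 := by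
  let b : ContDiffBump (0 : ℝ) := ⟨1, 2, one_pos, one_lt_two⟩
  refine ⟨fun x => (b x : ℂ), ofRealCLM.contDiff.comp b.contDiff, ?_, ?_⟩
  · exact b.hasCompactSupport.comp_left (g := fun r : ℝ => (r : ℂ)) ofReal_zero
  · simp [b.one_of_mem_closedBall (Metric.mem_closedBall_self b.rIn_pos.le)]

/-- The moments of a distributional solution of `𝔏 f = ζ f` satisfy a two-step recursion. -/
theorem FPeq.moment_recursion {a : ℝ} (ha : 0 < a) {f : ℝ → ℂ} (hf : HasExpMoment a f) {ζ : ℂ}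
    (h : FPeq f fun x => ζ * f x) (n : ℕ) :
    ((n : ℂ) + ζ) * ∫ x : ℝ, f x * (x : ℂ) ^ n =
      n * (n - 1 : ℕ) * ∫ x : ℝ, f x * (x : ℂ) ^ (n - 1 - 1) := by
  obtain ⟨χ, hχ, hχc, hχ0⟩ := exists_cutoff
  have hχ1 : ContDiff ℝ ∞ (deriv χ) := (contDiff_infty_iff_deriv.mp hχ).2
  have hχ2 : ContDiff ℝ ∞ (deriv (deriv χ)) := (contDiff_infty_iff_deriv.mp hχ1).2
  obtain ⟨C₀, hC₀⟩ := hχc.exists_bound_of_continuous hχ.continuous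
  obtain ⟨C₁, hC₁⟩ := hχc.deriv.exists_bound_of_continuous hχ1.continuous
  obtain ⟨C₂, hC₂⟩ := hχc.deriv.deriv.exists_bound_of_continuous hχ2.continuous
  have hcomp : ∀ η : ℝ → ℂ, ContDiff ℝ ∞ η → ∀ ε x : ℝ,
      HasDerivAt (fun y : ℝ => η (ε * y)) (ε * deriv η (ε * x)) x := by
    intro η hη ε x
    have h1 := (hη.differentiable (by simp) (ε * x)).hasDerivAt
    have h2 : HasDerivAt (fun y : ℝ => ε * y) ε x := by
      simpa using (hasDerivAt_id x).const_mul ε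
    simpa using! h1.scomp x h2
  have hpow : ∀ (m : ℕ) (x : ℝ),
      HasDerivAt (fun y : ℝ => (y : ℂ) ^ m) (m * (x : ℂ) ^ (m - 1)) x := by
    intro m x
    exact (hasDerivAt_pow m (x : ℂ)).comp_ofReal
  have hd1 : ∀ ε : ℝ, deriv (fun x : ℝ => (x : ℂ) ^ n * χ (ε * x)) = fun x : ℝ =>
      n * (x : ℂ) ^ (n - 1) * χ (ε * x) + (x : ℂ) ^ n * (ε * deriv χ (ε * x)) :=
    fun ε => funext fun x => ((hpow n x).mul (hcomp χ hχ ε x)).deriv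
  have hd2 : ∀ ε : ℝ, deriv (deriv (fun x : ℝ => (x : ℂ) ^ n * χ (ε * x))) = fun x : ℝ =>
      (n * ((n - 1 : ℕ) * (x : ℂ) ^ (n - 1 - 1)) * χ (ε * x)
        + n * (x : ℂ) ^ (n - 1) * (ε * deriv χ (ε * x)))
      + (n * (x : ℂ) ^ (n - 1) * (ε * deriv χ (ε * x))
        + (x : ℂ) ^ n * (ε * (ε * deriv (deriv χ) (ε * x)))) := by
    intro ε
    rw [hd1]
    exact funext fun x => ((((hpow (n - 1) x).const_mul (n : ℂ)).mul (hcomp χ hχ ε x)).add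
      ((hpow n x).mul ((hcomp _ hχ1 ε x).const_mul (ε : ℂ)))).deriv
  have hid : ∀ ε : ℝ, ε ≠ 0 →
      n * (n - 1 : ℕ) * (∫ x : ℝ, f x * ((x : ℂ) ^ (n - 1 - 1) * χ (ε * x)))
        + 2 * ε * n * (∫ x : ℝ, f x * ((x : ℂ) ^ (n - 1) * deriv χ (ε * x)))
        + ε ^ 2 * (∫ x : ℝ, f x * ((x : ℂ) ^ n * deriv (deriv χ) (ε * x)))
        - n * (∫ x : ℝ, f x * ((x : ℂ) ^ n * χ (ε * x)))
        - ε * (∫ x : ℝ, f x * ((x : ℂ) ^ (n + 1) * deriv χ (ε * x)))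
      = ζ * ∫ x : ℝ, f x * ((x : ℂ) ^ n * χ (ε * x)) := by
    intro ε hε
    have key := h (fun x : ℝ => (x : ℂ) ^ n * χ (ε * x))
      ((ofRealCLM.contDiff.pow n).mul (hχ.comp (contDiff_const.mul contDiff_id)))
      ((hχc.comp_homeomorph (Homeomorph.mulLeft₀ ε hε)).mul_left)
    simp only [mul_assoc ζ] at key
    rw [integral_const_mul] at key
    rw [← key, hd2, hd1]
    have i₀ := fun m => hf.integrable_mul_pow_mul ha hχ.continuous hC₀ m ε
    have i₁ := fun m => hf.integrable_mul_pow_mul ha hχ1.continuous hC₁ m ε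
    have i₂ := fun m => hf.integrable_mul_pow_mul ha hχ2.continuous hC₂ m ε
    simp only [← integral_const_mul]
    have j1 := (i₀ (n - 1 - 1)).const_mul (n * (n - 1 : ℕ) : ℂ)
    have j2 := (i₁ (n - 1)).const_mul (2 * ε * n : ℂ)
    have j3 := (i₂ n).const_mul ((ε : ℂ) ^ 2)
    have j4 := (i₀ n).const_mul (n : ℂ)
    have j5 := (i₁ (n + 1)).const_mul (ε : ℂ)
    have e := integral_sub' (((j1.add j2).add j3).sub j4) j5
    rw [integral_sub' ((j1.add j2).add j3) j4, integral_add' (j1.add j2) j3,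
      integral_add' j1 j2] at e
    refine e.symm.trans ?_
    congr 1 with x
    simp only [Pi.add_apply, Pi.sub_apply]
    have hx : (n : ℂ) * (x : ℂ) ^ n = n * ((x : ℂ) ^ (n - 1) * x) := by
      rcases n with _ | n
      · simp
      · simp [pow_succ]
    linear_combination (-f x * χ (ε * x)) * hx
  have hε : Filter.Tendsto (fun N : ℕ => 1 / ((N : ℝ) + 1)) Filter.atTop (nhds 0) :=
    tendsto_one_div_add_atTop_nhds_zero_nat
  have hεc : Filter.Tendsto (fun N : ℕ => ((1 / ((N : ℝ) + 1) : ℝ) : ℂ)) Filter.atTop (nhds 0) := by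
    rw [← ofReal_zero]
    exact (continuous_ofReal.tendsto 0).comp hε
  have t₀ := fun m => hf.tendsto_truncated_moment ha hχ.continuous hC₀ m hε
  have t₁ := fun m => hf.tendsto_truncated_moment ha hχ1.continuous hC₁ m hε
  have t₂ := fun m => hf.tendsto_truncated_moment ha hχ2.continuous hC₂ m hε
  have hl := (((((t₀ (n - 1 - 1)).const_mul (n * (n - 1 : ℕ) : ℂ)).add
    (((hεc.const_mul 2).mul_const (n : ℂ)).mul (t₁ (n - 1)))).add
    ((hεc.pow 2).mul (t₂ n))).sub ((t₀ n).const_mul (n : ℂ))).sub (hεc.mul (t₁ (n + 1)))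
  have hr := (t₀ n).const_mul ζ
  have := tendsto_nhds_unique (hl.congr fun N => hid _ (by positivity)) hr
  rw [hχ0] at this
  linear_combination -this

/-- A sequence obeying the moment recursion vanishes if its term of order `-ζ`, if any, does. -/
theorem moments_eq_zero {m : ℕ → ℂ} {ζ : ℂ}
    (hrec : ∀ n : ℕ, ((n : ℂ) + ζ) * m n = n * (n - 1 : ℕ) * m (n - 1 - 1))
    (h0 : ∀ k : ℕ, ζ = -(k : ℂ) → m k = 0) (n : ℕ) : m n = 0 := by
  induction n using Nat.strong_induction_on with
  | _ n ih =>
    by_cases hn : (n : ℂ) + ζ = 0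
    · exact h0 n (by linear_combination hn)
    · have : ((n : ℂ) + ζ) * m n = 0 := by
        rw [hrec]
        rcases n with _ | n
        · simp
        · rw [ih (n + 1 - 1 - 1) (by omega), mul_zero]
      exact (mul_eq_zero.mp this).resolve_left hn
/-- The `k`-th derivative of the Gaussian `e^{-x²/2}`. -/
noncomputable def gaussDeriv (k : ℕ) : ℝ → ℂ :=
  iteratedDeriv k fun y : ℝ => Complex.exp (-(y : ℂ) ^ 2 / 2)

theorem contDiff_gauss : ContDiff ℝ ∞ fun y : ℝ => Complex.exp (-(y : ℂ) ^ 2 / 2) :=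
  (((ofRealCLM.contDiff (n := ∞)).pow 2).neg.div_const 2).cexp

theorem hasDerivAt_gaussDeriv (k : ℕ) (x : ℝ) :
    HasDerivAt (gaussDeriv k) (gaussDeriv (k + 1) x) x := by
  rw [gaussDeriv, gaussDeriv, iteratedDeriv_succ]
  exact (contDiff_gauss.differentiable_iteratedDeriv k
    (by exact_mod_cast WithTop.coe_lt_top k) x).hasDerivAt

theorem continuous_gaussDeriv (k : ℕ) : Continuous (gaussDeriv k) :=
  continuous_iff_continuousAt.mpr fun x => (hasDerivAt_gaussDeriv k x).continuousAt

theorem gaussDeriv_zero (x : ℝ) : gaussDeriv 0 x = Complex.exp (-(x : ℂ) ^ 2 / 2) := by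
  simp [gaussDeriv]

theorem gaussDeriv_one (x : ℝ) : gaussDeriv 1 x = -(x * gaussDeriv 0 x) := by
  have h1 : HasDerivAt (fun y : ℝ => Complex.exp (-(y : ℂ) ^ 2 / 2))
      (Complex.exp (-(x : ℂ) ^ 2 / 2) * (-(2 * (x : ℂ)) / 2)) x := by
    have : HasDerivAt (fun z : ℂ => Complex.exp (-z ^ 2 / 2))
        (Complex.exp (-(x : ℂ) ^ 2 / 2) * (-(2 * (x : ℂ)) / 2)) (x : ℂ) := by
      simpa using ((hasDerivAt_pow 2 (x : ℂ)).neg.div_const 2).cexp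
    exact this.comp_ofReal
  have h2 := hasDerivAt_gaussDeriv 0 x
  rw [show gaussDeriv 0 = fun y : ℝ => Complex.exp (-(y : ℂ) ^ 2 / 2) from
    funext gaussDeriv_zero] at h2
  rw [h2.unique h1, gaussDeriv_zero]
  ring

theorem gaussDeriv_add_two (k : ℕ) (x : ℝ) :
    gaussDeriv (k + 2) x = -(x * gaussDeriv (k + 1) x + (k + 1) * gaussDeriv k x) := by
  have hid : ∀ x : ℝ, HasDerivAt (fun y : ℝ => (y : ℂ)) 1 x := fun x => ofRealCLM.hasDerivAt
  induction k generalizing x with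
  | zero =>
    have h1 := ((hid x).mul (hasDerivAt_gaussDeriv 0 x)).neg
    have h2 := hasDerivAt_gaussDeriv 1 x
    rw [show gaussDeriv 1 = fun y : ℝ => -((y : ℂ) * gaussDeriv 0 y) from
      funext gaussDeriv_one] at h2
    rw [h2.unique h1]
    push_cast
    ring
  | succ k ih =>
    have h1 := (((hid x).mul (hasDerivAt_gaussDeriv (k + 1) x)).add
      ((hasDerivAt_gaussDeriv k x).const_mul ((k : ℂ) + 1))).neg
    have h2 := hasDerivAt_gaussDeriv (k + 2) x
    rw [show gaussDeriv (k + 2) = fun y : ℝ =>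
      -(y * gaussDeriv (k + 1) y + (k + 1) * gaussDeriv k y) from funext ih] at h2
    rw [h2.unique h1]
    push_cast
    ring

theorem norm_gaussDeriv_le (k : ℕ) :
    ∃ C, 0 ≤ C ∧ ∀ x : ℝ, ‖gaussDeriv k x‖ ≤ C * (1 + |x|) ^ k * Real.exp (-x ^ 2 / 2) := by
  have h0 : ∀ x : ℝ, ‖gaussDeriv 0 x‖ = Real.exp (-x ^ 2 / 2) := fun x => by
    rw [gaussDeriv_zero, Complex.norm_exp]
    congr 1
    rw [show -(x : ℂ) ^ 2 / 2 = ((-x ^ 2 / 2 : ℝ) : ℂ) by push_cast; ring, ofReal_re]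
  induction k using Nat.twoStepInduction with
  | zero => exact ⟨1, zero_le_one, fun x => by rw [h0]; simp⟩
  | one =>
    refine ⟨1, zero_le_one, fun x => ?_⟩
    rw [gaussDeriv_one, norm_neg, norm_mul, h0, norm_real, Real.norm_eq_abs]
    gcongr
    linarith
  | more k ih₁ ih₂ =>
    obtain ⟨C, hC, h₁⟩ := ih₁
    obtain ⟨D, hD, h₂⟩ := ih₂
    refine ⟨D + (k + 1) * C, by positivity, fun x => ?_⟩
    have hk : ‖((k : ℂ) + 1)‖ = k + 1 := by
      rw [← Nat.cast_add_one, norm_natCast, Nat.cast_add_one]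
    have hx := abs_nonneg x
    set E := Real.exp (-x ^ 2 / 2) with hE
    have hE0 : 0 < E := Real.exp_pos _
    calc ‖gaussDeriv (k + 2) x‖ ≤ |x| * ‖gaussDeriv (k + 1) x‖ + (k + 1) * ‖gaussDeriv k x‖ := by
          rw [gaussDeriv_add_two, norm_neg]
          refine (norm_add_le _ _).trans ?_
          rw [norm_mul, norm_mul, hk, norm_real, Real.norm_eq_abs]
      _ ≤ (1 + |x|) * (D * (1 + |x|) ^ (k + 1) * E) + (k + 1) * (C * (1 + |x|) ^ (k + 2) * E) := by
          refine add_le_add (mul_le_mul (by linarith) (h₂ x) (norm_nonneg _) (by positivity))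
            (mul_le_mul_of_nonneg_left ((h₁ x).trans ?_) (by positivity))
          gcongr <;> linarith
      _ = _ := by ring

theorem memE_gaussDeriv (β : ℝ) (k : ℕ) : memE β (gaussDeriv k) := by
  have hm := (continuous_gaussDeriv k).aestronglyMeasurable (μ := volume)
  obtain ⟨C, hC, hb⟩ := norm_gaussDeriv_le k
  refine ⟨hm, ?_⟩
  have hi : Integrable fun x : ℝ => (C * (k.factorial * Real.exp 1)) ^ 2 *
      Real.exp ((2 + |β|) ^ 2 / 2) * Real.exp (-(1 / 2) * x ^ 2) :=
    (integrable_exp_neg_mul_sq (by norm_num)).const_mul _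
  refine hi.mono' ((hm.norm.pow 2).mul (by fun_prop)) (.of_forall fun x => ?_)
  have h1 : (1 + |x|) ^ k ≤ k.factorial * Real.exp 1 * Real.exp |x| := by
    have := Real.pow_div_factorial_le_exp (1 + |x|) (by positivity) k
    rw [div_le_iff₀ (by positivity), Real.exp_add] at this
    linarith
  have h2 : ‖gaussDeriv k x‖ ≤
      C * (k.factorial * Real.exp 1) * (Real.exp |x| * Real.exp (-x ^ 2 / 2)) := by
    calc _ ≤ C * (1 + |x|) ^ k * Real.exp (-x ^ 2 / 2) := hb x
      _ ≤ C * (k.factorial * Real.exp 1 * Real.exp |x|) * Real.exp (-x ^ 2 / 2) := by gcongr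
      _ = _ := by ring
  have h3 : Real.cosh (β * x) ≤ Real.exp (|β| * |x|) := by
    rw [← Real.cosh_abs, abs_mul, Real.cosh_eq]
    have : Real.exp (-(|β| * |x|)) ≤ Real.exp (|β| * |x|) :=
      Real.exp_le_exp.mpr (by linarith [mul_nonneg (abs_nonneg β) (abs_nonneg x)])
    linarith
  rw [norm_mul, norm_pow, norm_norm, Real.norm_eq_abs, abs_of_pos (Real.cosh_pos _)]
  calc ‖gaussDeriv k x‖ ^ 2 * Real.cosh (β * x)
      ≤ (C * (k.factorial * Real.exp 1) * (Real.exp |x| * Real.exp (-x ^ 2 / 2))) ^ 2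
          * Real.exp (|β| * |x|) := by gcongr
    _ = (C * (k.factorial * Real.exp 1)) ^ 2 *
          Real.exp (2 * (|x| + -x ^ 2 / 2) + |β| * |x|) := by
        rw [mul_pow, ← Real.exp_add, Real.exp_add (2 * _), ← Real.exp_nat_mul]
        push_cast
        ring
    _ ≤ (C * (k.factorial * Real.exp 1)) ^ 2 *
          Real.exp ((2 + |β|) ^ 2 / 2 + -(1 / 2) * x ^ 2) := by
        refine mul_le_mul_of_nonneg_left (Real.exp_le_exp.mpr ?_) (by positivity)
        rw [neg_div, ← sq_abs x]
        nlinarith [sq_nonneg (2 + |β| - |x|)]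
    _ = _ := by rw [Real.exp_add]; ring

theorem FPeq_gaussDeriv (k : ℕ) :
    FPeq (gaussDeriv k) fun x => -(k : ℂ) * gaussDeriv k x := by
  intro φ hφ hφc
  have hφ1 : ContDiff ℝ ∞ (deriv φ) := (contDiff_infty_iff_deriv.mp hφ).2
  have hφ2 : ContDiff ℝ ∞ (deriv (deriv φ)) := (contDiff_infty_iff_deriv.mp hφ1).2
  have hφd : ∀ x, HasDerivAt φ (deriv φ x) x :=
    fun x => (hφ.differentiable (by simp) x).hasDerivAt
  have hφd1 : ∀ x, HasDerivAt (deriv φ) (deriv (deriv φ) x) x :=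
    fun x => (hφ1.differentiable (by simp) x).hasDerivAt
  have hid : ∀ x : ℝ, HasDerivAt (fun y : ℝ => (y : ℂ)) 1 x := fun x => ofRealCLM.hasDerivAt
  have hG := continuous_gaussDeriv k
  have hG1 := continuous_gaussDeriv (k + 1)
  have c0 := hφ.continuous
  have c1 := hφ1.continuous
  have c2 := hφ2.continuous
  have hder : ∀ x : ℝ, HasDerivAt (fun x : ℝ => gaussDeriv k x * deriv φ x
      - (gaussDeriv (k + 1) x + x * gaussDeriv k x) * φ x)
      (gaussDeriv k x * (deriv (deriv φ) x - x * deriv φ x) - -(k : ℂ) * gaussDeriv k x * φ x)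
      x := by
    intro x
    convert! ((hasDerivAt_gaussDeriv k x).mul (hφd1 x)).sub
      (((hasDerivAt_gaussDeriv (k + 1) x).add ((hid x).mul (hasDerivAt_gaussDeriv k x))).mul
        (hφd x)) using 1
    simp only [Pi.add_apply, Pi.mul_apply, gaussDeriv_add_two]
    ring
  have s1 : HasCompactSupport fun x : ℝ => deriv (deriv φ) x - x * deriv φ x :=
    hφc.deriv.deriv.sub hφc.deriv.mul_left
  have i1 : Integrable fun x : ℝ => gaussDeriv k x * (deriv (deriv φ) x - x * deriv φ x) :=
    Continuous.integrable_of_hasCompactSupport (by fun_prop) s1.mul_left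
  have i2 : Integrable fun x : ℝ => -(k : ℂ) * gaussDeriv k x * φ x :=
    Continuous.integrable_of_hasCompactSupport (by fun_prop) hφc.mul_left
  have := integral_eq_zero_of_hasDerivAt_of_integrable hder (i1.sub i2)
    (Continuous.integrable_of_hasCompactSupport (by fun_prop)
      (hφc.deriv.mul_left.sub hφc.mul_left))
  rw [integral_sub i1 i2] at this
  exact sub_eq_zero.mp this

theorem integral_gaussDeriv_mul_pow_ne_zero (k : ℕ) :
    ∫ x : ℝ, gaussDeriv k x * (x : ℂ) ^ k ≠ 0 := by
  have hint : ∀ k n : ℕ, Integrable fun x : ℝ => gaussDeriv k x * (x : ℂ) ^ n := fun k n =>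
    ((memE_gaussDeriv 4 k).hasExpMoment four_pos).integrable_mul_pow (by norm_num) n
  induction k with
  | zero =>
    have : ∀ x : ℝ, gaussDeriv 0 x * (x : ℂ) ^ 0 = ((Real.exp (-(1 / 2) * x ^ 2) : ℝ) : ℂ) := by
      intro x
      rw [gaussDeriv_zero, pow_zero, mul_one, ofReal_exp]
      congr 1
      push_cast
      ring
    simp only [this]
    rw [integral_complex_ofReal, integral_gaussian, ofReal_ne_zero]
    positivity
  | succ k ih =>
    have hder : ∀ x : ℝ, HasDerivAt (fun x : ℝ => gaussDeriv k x * (x : ℂ) ^ (k + 1))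
        (gaussDeriv (k + 1) x * (x : ℂ) ^ (k + 1) + (k + 1) * (gaussDeriv k x * (x : ℂ) ^ k))
        x := by
      intro x
      convert! (hasDerivAt_gaussDeriv k x).mul (hasDerivAt_pow (k + 1) (x : ℂ)).comp_ofReal using 1
      push_cast
      ring
    have i2 := (hint k k).const_mul ((k : ℂ) + 1)
    have := integral_eq_zero_of_hasDerivAt_of_integrable hder
      ((hint (k + 1) (k + 1)).add i2) (hint k (k + 1))
    rw [integral_add (hint (k + 1) (k + 1)) i2, integral_const_mul] at this
    intro h0
    rw [h0, zero_add] at this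
    exact (mul_ne_zero (Nat.cast_add_one_ne_zero k) ih) this

/-- the eigenvalue equation `𝔏 f = ζ f` has a nonzero solution `f ∈ ℰ`
iff `ζ = −k` for some `k ∈ ℕ₀`; in that case every solution is a scalar multiple of
`μ_k`, so each eigenspace is one-dimensional. -/
theorem fokkerPlanck_eigenvalues (β : ℝ) (hβ : 0 < β) (ζ : ℂ) :
    ((∃ f : ℝ → ℂ, memE β f ∧ ¬ f =ᵐ[volume] 0 ∧ FPeq f (fun x => ζ * f x))
        ↔ ∃ k : ℕ, ζ = -(k : ℂ)) ∧
    (∀ k : ℕ, ζ = -(k : ℂ) →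
      ∀ f : ℝ → ℂ, memE β f → FPeq f (fun x => ζ * f x) →
        ∃ c : ℂ, f =ᵐ[volume] fun x => c * muk k x) := by

  have ha : 0 < β / 4 := by linarith
  refine ⟨⟨?_, ?_⟩, ?_⟩
  · rintro ⟨f, hf, hf0, hfe⟩
    by_contra! hζ
    have hE := hf.hasExpMoment hβ
    exact hf0 (hE.ae_eq_zero ha (moments_eq_zero (hfe.moment_recursion ha hE)
      fun k hk => absurd hk (hζ k)))
  · rintro ⟨k, rfl⟩
    refine ⟨gaussDeriv k, memE_gaussDeriv β k, fun h => ?_, FPeq_gaussDeriv k⟩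
    refine integral_gaussDeriv_mul_pow_ne_zero k (integral_eq_zero_of_ae ?_)
    filter_upwards [h] with x hx
    simp [hx]
  · rintro k rfl f hf hfe
    have hE := hf.hasExpMoment hβ
    have hG := (memE_gaussDeriv β k).hasExpMoment hβ
    set M := ∫ x : ℝ, gaussDeriv k x * (x : ℂ) ^ k with hM
    have hM0 : M ≠ 0 := integral_gaussDeriv_mul_pow_ne_zero k
    set c := (∫ x : ℝ, f x * (x : ℂ) ^ k) / M with hc
    have hsplit : ∀ n : ℕ, ∫ x : ℝ, (f x - c * gaussDeriv k x) * (x : ℂ) ^ n =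
        (∫ x : ℝ, f x * (x : ℂ) ^ n) - c * ∫ x : ℝ, gaussDeriv k x * (x : ℂ) ^ n := by
      intro n
      rw [← integral_const_mul, ← integral_sub (hE.integrable_mul_pow ha n)
        ((hG.integrable_mul_pow ha n).const_mul c)]
      congr 1 with x
      ring
    have hzero := (hE.sub_const_mul hG c).ae_eq_zero ha (moments_eq_zero (ζ := -(k : ℂ))
      (fun n => by
        simp only [hsplit]
        linear_combination hfe.moment_recursion ha hE n
          - c * (FPeq_gaussDeriv k).moment_recursion ha hG n)
      (fun j hj => by
        obtain rfl : k = j := by exact_mod_cast neg_injective hj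
        rw [hsplit, ← hM, hc, div_mul_cancel₀ _ hM0, sub_self]))
    have hs : (Real.sqrt (2 * Real.pi) : ℂ) ≠ 0 := by
      rw [ofReal_ne_zero]
      positivity
    refine ⟨c * Real.sqrt (2 * Real.pi), ?_⟩
    filter_upwards [hzero] with x hx
    rw [sub_eq_zero.mp hx, muk, ← mul_assoc, mul_assoc c, mul_inv_cancel₀ hs, mul_one]
    rfl
end

section
/- Let k ∈ ℕ. The closure in ℰ of the set {f ∈ L²(ℝ, e^{x²/2}dx) : ∫_ℝ f(x) x^j dx = 0 for all 0 ≤ j ≤ k−1} equals the set ℰ_k = {f ∈ ℰ : ∫_ℝ f(x) x^j dx = 0 for all 0 ≤ j ≤ k−1}. (Note that L²(ℝ, e^{x²/2}dx) ⊂ ℰ and that for f ∈ ℰ the moment integrals ∫ f(x) x^j dx converge absolutely.) -/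
open MeasureTheory Complex
open scoped ENNReal

/-- The weighted measure `cosh(βx) dx` on `ℝ`. -/
noncomputable def muE (β : ℝ) : Measure ℝ :=
  volume.withDensity fun x => ENNReal.ofReal (Real.cosh (β * x))

/-- The kernel of a continuous linear map into a finite-dimensional space is contained in the
closure of its intersection with any dense subspace. -/
theorem ker_subset_closure_inter_of_dense {V F : Type*} [NormedAddCommGroup V] [NormedSpace ℂ V]
    [NormedAddCommGroup F] [NormedSpace ℂ F] [FiniteDimensional ℂ F] (D : Submodule ℂ V)
    (hD : Dense (D : Set V)) (L : V →L[ℂ] F) :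
    {f | L f = 0} ⊆ closure ((D : Set V) ∩ {f | L f = 0}) := by
  intro f hf
  have hf : L f = 0 := hf
  let R : Submodule ℂ F := D.map (L : V →ₗ[ℂ] F)
  have hmem : ∀ v, L v ∈ R := by
    intro v
    have hcl : IsClosed (R : Set F) := R.closed_of_finiteDimensional
    have hsub : closure (D : Set V) ⊆ L ⁻¹' R :=
      closure_minimal (fun d hd => Submodule.mem_map_of_mem hd) (hcl.preimage L.continuous)
    exact hsub (hD v)
  obtain ⟨s, hs⟩ : ∃ s : R →ₗ[ℂ] D, ∀ r : R, L (s r : V) = r := by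
    let T : D →ₗ[ℂ] R := (L : V →ₗ[ℂ] F).submoduleMap D
    obtain ⟨s, hs⟩ := T.exists_rightInverse_of_surjective
      (LinearMap.range_eq_top.2 ((L : V →ₗ[ℂ] F).submoduleMap_surjective D))
    exact ⟨s, fun r => congrArg Subtype.val (LinearMap.congr_fun hs r)⟩
  let P : V → V := fun v => v - (s ⟨L v, hmem v⟩ : V)
  have hP : Continuous P := by
    have hsc : Continuous s := s.continuous_of_finiteDimensional
    exact continuous_id.sub (continuous_subtype_val.comp
      (hsc.comp (L.continuous.subtype_mk hmem)))
  have hPf : P f = f := by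
    have : (⟨L f, hmem f⟩ : R) = 0 := Subtype.ext hf
    simp [P, this]
  rw [← hPf]
  refine map_mem_closure hP (hD f) fun d hd => ⟨D.sub_mem hd (s _).2, ?_⟩
  change L (d - _) = 0
  rw [map_sub, hs, sub_self]

theorem abs_pow_le_cosh {β : ℝ} (hβ : 0 < β) (n : ℕ) (x : ℝ) :
    |x| ^ n ≤ 2 * n.factorial / β ^ n * Real.cosh (β * x) := by
  have h₁ := Real.pow_div_factorial_le_exp (β * |x|) (by positivity) n
  have h₂ : Real.exp (β * |x|) ≤ 2 * Real.cosh (β * x) := by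
    rw [← Real.cosh_abs (β * x), abs_mul, abs_of_pos hβ, Real.cosh_eq]
    have := Real.exp_pos (-(β * |x|))
    linarith
  have h₃ := h₁.trans h₂
  rw [div_le_iff₀ (by positivity), mul_pow] at h₃
  rw [div_mul_eq_mul_div, le_div_iff₀ (by positivity)]
  linarith

theorem integrable_pow_div_cosh {β : ℝ} (hβ : 0 < β) (n : ℕ) :
    Integrable fun x : ℝ => |x| ^ n / Real.cosh (β * x) := by
  refine (integrable_inv_one_add_sq.const_mul
    (2 * n.factorial / β ^ n + 2 * (n + 2).factorial / β ^ (n + 2))).mono' ?_ (.of_forall fun x => ?_)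
  · have : Continuous fun x : ℝ => |x| ^ n / Real.cosh (β * x) :=
      Continuous.div (by fun_prop) (by fun_prop) fun x => (Real.cosh_pos _).ne'
    exact this.aestronglyMeasurable
  · have hc := Real.cosh_pos (β * x)
    have h₁ := abs_pow_le_cosh hβ n x
    have h₂ := abs_pow_le_cosh hβ (n + 2) x
    rw [pow_add, sq_abs] at h₂
    rw [Real.norm_of_nonneg (by positivity), ← div_eq_mul_inv, div_le_div_iff₀ hc (by positivity)]
    linarith

theorem measurable_muE_density (β : ℝ) :
    Measurable fun x : ℝ => ENNReal.ofReal (Real.cosh (β * x)) := by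
  fun_prop

theorem volume_absolutelyContinuous_muE (β : ℝ) : (volume : Measure ℝ) ≪ muE β :=
  withDensity_absolutelyContinuous' (measurable_muE_density β).aemeasurable
    (.of_forall fun x => by simpa using Real.cosh_pos (β * x))

theorem integral_muE (β : ℝ) (h : ℝ → ℂ) :
    ∫ x, h x ∂(muE β) = ∫ x : ℝ, Real.cosh (β * x) • h x := by
  rw [muE, integral_withDensity_eq_integral_toReal_smul (measurable_muE_density β)
    (.of_forall fun x => ENNReal.ofReal_lt_top)]
  simp only [ENNReal.toReal_ofReal (Real.cosh_pos _).le]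

/-- The representer in `L²(cosh βx dx)` of the `j`-th moment functional. -/
theorem memLp_moment {β : ℝ} (hβ : 0 < β) (j : ℕ) :
    MemLp (fun x : ℝ => ((x ^ j / Real.cosh (β * x) : ℝ) : ℂ)) 2 (muE β) := by
  have hcont : Continuous fun x : ℝ => x ^ j / Real.cosh (β * x) :=
    Continuous.div (by fun_prop) (by fun_prop) fun x => (Real.cosh_pos _).ne'
  have hmeas : AEStronglyMeasurable
      (fun x : ℝ => ((x ^ j / Real.cosh (β * x) : ℝ) : ℂ)) (muE β) :=
    (Complex.continuous_ofReal.comp hcont).aestronglyMeasurable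
  rw [memLp_two_iff_integrable_sq_norm hmeas, muE,
    integrable_withDensity_iff_integrable_smul' (measurable_muE_density β)
      (.of_forall fun x => ENNReal.ofReal_lt_top)]
  refine (integrable_pow_div_cosh hβ (2 * j)).congr (.of_forall fun x => ?_)
  have hc := Real.cosh_pos (β * x)
  simp only [ENNReal.toReal_ofReal hc.le, Complex.norm_real, Real.norm_eq_abs, sq_abs, smul_eq_mul]
  rw [pow_mul, sq_abs, div_pow, ← pow_mul, ← pow_mul, mul_comm 2 j]
  field_simp

theorem exists_moment_clm {β : ℝ} (hβ : 0 < β) (j : ℕ) :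
    ∃ L : Lp ℂ 2 (muE β) →L[ℂ] ℂ, ∀ f : Lp ℂ 2 (muE β), L f = ∫ x : ℝ, f x * (x : ℂ) ^ j := by
  refine ⟨innerSL ℂ ((memLp_moment hβ j).toLp _), fun f => ?_⟩
  rw [innerSL_apply_apply, L2.inner_def]
  have hcongr : ∀ᵐ x ∂(muE β), inner ℂ ((memLp_moment hβ j).toLp _ x) (f x) =
      f x * ((x ^ j / Real.cosh (β * x) : ℝ) : ℂ) := by
    filter_upwards [(memLp_moment hβ j).coeFn_toLp] with x hx
    rw [hx, RCLike.inner_apply, Complex.conj_ofReal]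
  rw [integral_congr_ae hcongr, integral_muE]
  refine integral_congr_ae (.of_forall fun x => ?_)
  have hc' : (Real.cosh (β * x) : ℂ) ≠ 0 := by exact_mod_cast (Real.cosh_pos (β * x)).ne'
  simp only [Complex.real_smul, Complex.ofReal_div, Complex.ofReal_pow]
  field_simp

/-- The classes in `L²(μ)` of continuous functions with compact support. -/
def compactlySupportedLp (μ : Measure ℝ) : Submodule ℂ (Lp ℂ 2 μ) where
  carrier := {f | ∃ g : ℝ → ℂ, Continuous g ∧ HasCompactSupport g ∧ f =ᵐ[μ] g}
  zero_mem' := ⟨0, continuous_zero, HasCompactSupport.zero, Lp.coeFn_zero ℂ 2 μ⟩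
  add_mem' := by
    rintro f₁ f₂ ⟨g₁, hg₁, hs₁, h₁⟩ ⟨g₂, hg₂, hs₂, h₂⟩
    exact ⟨g₁ + g₂, hg₁.add hg₂, hs₁.add hs₂, (Lp.coeFn_add f₁ f₂).trans (h₁.add h₂)⟩
  smul_mem' := by
    rintro c f ⟨g, hg, hs, h⟩
    exact ⟨c • g, hg.const_smul c, hs.smul_left (f := fun _ => c),
      (Lp.coeFn_smul c f).trans (h.const_smul c)⟩

theorem dense_compactlySupportedLp (μ : Measure ℝ) [IsLocallyFiniteMeasure μ] :
    Dense (compactlySupportedLp μ : Set (Lp ℂ 2 μ)) := by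
  intro f
  rw [EMetric.mem_closure_iff]
  intro ε hε
  obtain ⟨δ, hδ, hδε⟩ := exists_between hε
  obtain ⟨g, hs, hle, hg, hmem⟩ :=
    (Lp.memLp f).exists_hasCompactSupport_eLpNorm_sub_le (by simp) hδ.ne'
  refine ⟨hmem.toLp g, ⟨g, hg, hs, hmem.coeFn_toLp⟩, lt_of_le_of_lt ?_ hδε⟩
  rw [Lp.edist_def, eLpNorm_congr_ae (Filter.EventuallyEq.rfl.sub hmem.coeFn_toLp)]
  exact hle

/-- for `k ≥ 1`, the closure in `ℰ = L²(cosh βx dx)` of the set of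
functions in `E = L²(e^{x²/2} dx) ⊂ ℰ` with vanishing moments of order `< k`
is exactly `ℰ_k`, the set of all `f ∈ ℰ` with vanishing moments of order `< k`. -/
theorem closure_of_Ek (β : ℝ) (hβ : 0 < β) (k : ℕ) (hk : 0 < k) :
    closure {f : Lp ℂ 2 (muE β) |
        (∫⁻ x : ℝ, (‖f x‖₊ : ℝ≥0∞) ^ 2 * ENNReal.ofReal (Real.exp (x ^ 2 / 2))) < ⊤ ∧
        ∀ j < k, ∫ x : ℝ, f x * (x : ℂ) ^ j = 0}
      = {f : Lp ℂ 2 (muE β) | ∀ j < k, ∫ x : ℝ, f x * (x : ℂ) ^ j = 0} := by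
  choose M hM using exists_moment_clm hβ
  let L : Lp ℂ 2 (muE β) →L[ℂ] (Fin k → ℂ) := ContinuousLinearMap.pi fun i => M i
  have hker : {f : Lp ℂ 2 (muE β) | ∀ j < k, ∫ x : ℝ, f x * (x : ℂ) ^ j = 0} =
      {f | L f = 0} := by
    ext f
    simp [L, funext_iff, hM, Fin.forall_iff]
  have : IsLocallyFiniteMeasure (muE β) :=
    IsLocallyFiniteMeasure.withDensity_ofReal (by fun_prop)
  refine (closure_minimal (fun f hf => hf.2) ?_).antisymm ?_
  · rw [hker]
    exact isClosed_eq L.continuous continuous_const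
  · rw [hker]
    refine (ker_subset_closure_inter_of_dense _ (dense_compactlySupportedLp _) L).trans
      (closure_mono ?_)
    rintro f ⟨⟨g, hg, hs, hfg⟩, hf⟩
    refine ⟨?_, hker.symm.subset hf⟩
    have hcont : Continuous fun x : ℝ => ‖g x‖ ^ 2 * Real.exp (x ^ 2 / 2) := by fun_prop
    have hint : Integrable fun x : ℝ => ‖g x‖ ^ 2 * Real.exp (x ^ 2 / 2) :=
      hcont.integrable_of_hasCompactSupport
        (hs.mono fun x hx hgx => hx (by simp [hgx]))
    refine lt_of_eq_of_lt (lintegral_congr_ae ?_) hint.hasFiniteIntegral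
    filter_upwards [(volume_absolutelyContinuous_muE β).ae_eq hfg] with x hx
    rw [hx, enorm_mul, enorm_pow, enorm_norm, Real.enorm_of_nonneg (Real.exp_pos _).le]
    rfl
end

section
/- For every k ∈ ℕ₀ there exists a constant C_k > 0 with the following property: for every t ≥ 0 and every f ∈ ℰ_k, the function S(t)f ∈ ℰ determined by ℱ[S(t)f](ξ) = exp(−(ξ²/2)(1−e^{−2t})) f̂(ξ e^{−t}) again lies in ℰ_k and satisfies ‖S(t)f‖_ω ≤ C_k e^{−kt} ‖f‖_ω. -/
open MeasureTheory Complex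

/-- Fourier transform with the paper's normalization `f̂(ξ) = ∫ f(x) e^{−ixξ} dx`. -/
noncomputable def FT (f : ℝ → ℂ) (ξ : ℝ) : ℂ :=
  ∫ x : ℝ, f x * Complex.exp (-(Complex.I * x * ξ))

/-- Membership in `ℰ_k`: an element of `ℰ` whose moments of order `< k` all vanish. -/
def memEk (β : ℝ) (k : ℕ) (f : ℝ → ℂ) : Prop :=
  memE β f ∧ ∀ j < k, ∫ x : ℝ, f x * (x : ℂ) ^ j = 0

lemma integrable_exp_neg_mul_abs {c : ℝ} (hc : 0 < c) :
    Integrable (fun x : ℝ => Real.exp (-(c * |x|))) := by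
  rw [← integrableOn_univ, ← Set.Iic_union_Ioi (a := (0 : ℝ))]
  refine IntegrableOn.union ?_ ?_
  · refine (integrableOn_exp_mul_Iic hc 0).congr_fun (fun x hx => ?_) measurableSet_Iic
    simp [abs_of_nonpos (Set.mem_Iic.1 hx)]
  · refine (exp_neg_integrableOn_Ioi 0 hc).congr_fun (fun x hx => ?_) measurableSet_Ioi
    simp [abs_of_pos (Set.mem_Ioi.1 hx)]

lemma exp_mul_abs_le_two_mul_cosh (β x : ℝ) :
    Real.exp (β * |x|) ≤ 2 * Real.cosh (β * x) := by
  rw [Real.cosh_eq]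
  rcases abs_cases x with ⟨h, _⟩ | ⟨h, _⟩ <;> rw [h]
  · linarith [Real.exp_pos (-(β * x))]
  · rw [mul_neg]; linarith [Real.exp_pos (β * x)]

lemma cosh_le_exp_mul_abs {β : ℝ} (hβ : 0 ≤ β) (x : ℝ) :
    Real.cosh (β * x) ≤ Real.exp (β * |x|) := by
  rw [Real.cosh_eq]
  have h1 : Real.exp (β * x) ≤ Real.exp (β * |x|) :=
    Real.exp_le_exp.2 (mul_le_mul_of_nonneg_left (le_abs_self x) hβ)
  have h2 : Real.exp (-(β * x)) ≤ Real.exp (β * |x|) := by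
    rw [← mul_neg]
    exact Real.exp_le_exp.2 (mul_le_mul_of_nonneg_left (neg_le_abs x) hβ)
  linarith

lemma cosh_add_le_two_mul (x y : ℝ) :
    Real.cosh (x + y) ≤ 2 * Real.cosh x * Real.cosh y := by
  have h : Real.cosh (x - y) = Real.cosh x * Real.cosh y - Real.sinh x * Real.sinh y :=
    Real.cosh_sub x y
  linarith [Real.cosh_add x y, Real.cosh_pos (x - y)]

lemma exists_one_add_abs_pow_le_exp {c : ℝ} (hc : 0 < c) (m : ℕ) :
    ∃ C : ℝ, 0 < C ∧ ∀ x : ℝ, (1 + |x|) ^ m ≤ C * Real.exp (c * |x|) := by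
  refine ⟨m.factorial / c ^ m * Real.exp c, by positivity, fun x => ?_⟩
  have h := Real.pow_div_factorial_le_exp (c * (1 + |x|)) (by positivity) m
  have hf : (0 : ℝ) < m.factorial := by positivity
  rw [div_le_iff₀ hf, mul_pow, mul_add, mul_one, Real.exp_add] at h
  rw [div_mul_eq_mul_div, div_mul_eq_mul_div, le_div_iff₀ (by positivity)]
  linarith

lemma integral_mul_le_sqrt_mul_sqrt {u w : ℝ → ℝ} (hu0 : ∀ x, 0 ≤ u x) (hw0 : ∀ x, 0 ≤ w x)
    (hu : AEStronglyMeasurable u) (hw : AEStronglyMeasurable w)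
    (hu2 : Integrable fun x => u x ^ 2) (hw2 : Integrable fun x => w x ^ 2) :
    Integrable (fun x => u x * w x) ∧
      ∫ x, u x * w x ≤ Real.sqrt (∫ x, u x ^ 2) * Real.sqrt (∫ x, w x ^ 2) := by
  have hu' : MemLp u 2 := (memLp_two_iff_integrable_sq hu).2 hu2
  have hw' : MemLp w 2 := (memLp_two_iff_integrable_sq hw).2 hw2
  refine ⟨hu'.integrable_mul hw', ?_⟩
  have h := integral_mul_le_Lp_mul_Lq_of_nonneg Real.HolderConjugate.two_two
    (Filter.Eventually.of_forall hu0) (Filter.Eventually.of_forall hw0)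
    (by simpa using hu') (by simpa using hw')
  simpa [Real.sqrt_eq_rpow] using h

/-- An exponential weight of rate `β / 4` is controlled by the norm of `ℰ`. -/
lemma exists_integral_norm_mul_exp_le {β : ℝ} (hβ : 0 < β) :
    ∃ D : ℝ, 0 < D ∧ ∀ f : ℝ → ℂ, memE β f →
      Integrable (fun y => ‖f y‖ * Real.exp (β / 4 * |y|)) ∧
        ∫ y, ‖f y‖ * Real.exp (β / 4 * |y|) ≤ D * normE β f := by
  set w : ℝ → ℝ := fun y => Real.exp (β / 4 * |y|) / Real.sqrt (Real.cosh (β * y)) with hw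
  have hcosh : ∀ y, 0 < Real.sqrt (Real.cosh (β * y)) := fun y =>
    Real.sqrt_pos.2 (Real.cosh_pos _)
  have hsq : ∀ y, Real.sqrt (Real.cosh (β * y)) ^ 2 = Real.cosh (β * y) := fun y =>
    Real.sq_sqrt (Real.cosh_pos _).le
  have hsc : Continuous fun y : ℝ => Real.sqrt (Real.cosh (β * y)) :=
    Real.continuous_sqrt.comp (Real.continuous_cosh.comp (continuous_const.mul continuous_id))
  have hwc : Continuous w :=
    Continuous.div (by fun_prop) hsc fun y => (hcosh y).ne'
  have hw2 : Integrable fun y => w y ^ 2 := by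
    refine ((integrable_exp_neg_mul_abs (half_pos hβ)).const_mul 2).mono'
      (hwc.pow 2).aestronglyMeasurable (Filter.Eventually.of_forall fun y => ?_)
    rw [Real.norm_of_nonneg (by positivity), hw]
    simp only [div_pow, hsq]
    rw [div_le_iff₀ (Real.cosh_pos _), ← Real.exp_nat_mul]
    have h := mul_le_mul_of_nonneg_left (exp_mul_abs_le_two_mul_cosh β y)
      (Real.exp_pos (-(β / 2 * |y|))).le
    rw [← Real.exp_add] at h
    have e : -(β / 2 * |y|) + β * |y| = ((2 : ℕ) : ℝ) * (β / 4 * |y|) := by push_cast; ring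
    rw [e] at h
    linarith
  refine ⟨Real.sqrt (∫ y, w y ^ 2) + 1, by positivity, fun f hf => ?_⟩
  have hu2 : (fun y => (‖f y‖ * Real.sqrt (Real.cosh (β * y))) ^ 2) =
      fun y => ‖f y‖ ^ 2 * Real.cosh (β * y) := by
    funext y; rw [mul_pow, hsq]
  obtain ⟨h1, h2⟩ := integral_mul_le_sqrt_mul_sqrt
    (u := fun y => ‖f y‖ * Real.sqrt (Real.cosh (β * y))) (w := w)
    (fun y => by positivity) (fun y => by positivity)
    (hf.1.norm.mul hsc.aestronglyMeasurable) hwc.aestronglyMeasurable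
    (by rw [hu2]; exact hf.2) hw2
  have e : (fun y => ‖f y‖ * Real.sqrt (Real.cosh (β * y)) * w y) =
      fun y => ‖f y‖ * Real.exp (β / 4 * |y|) := by
    funext y
    have := (hcosh y).ne'
    simp only [hw]
    field_simp
  rw [e] at h1 h2
  rw [hu2] at h2
  refine ⟨h1, h2.trans ?_⟩
  rw [normE]
  nlinarith [Real.sqrt_nonneg (∫ y, ‖f y‖ ^ 2 * Real.cosh (β * y))]

lemma memE.integrable_norm_mul_one_add_abs_pow {β : ℝ} (hβ : 0 < β) {f : ℝ → ℂ}
    (hf : memE β f) (m : ℕ) : Integrable fun y => ‖f y‖ * (1 + |y|) ^ m := by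
  obtain ⟨D, -, hD⟩ := exists_integral_norm_mul_exp_le hβ
  obtain ⟨C, -, hC⟩ := exists_one_add_abs_pow_le_exp (c := β / 4) (by positivity) m
  refine ((hD f hf).1.const_mul C).mono'
    (hf.1.norm.mul (by fun_prop : Continuous fun y : ℝ => (1 + |y|) ^ m).aestronglyMeasurable)
    (Filter.Eventually.of_forall fun y => ?_)
  rw [Real.norm_of_nonneg (by positivity)]
  nlinarith [mul_le_mul_of_nonneg_left (hC y) (norm_nonneg (f y))]

lemma exists_gaussian_mul_polynomial_le (A : ℝ) (p : Polynomial ℝ) :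
    ∃ C : ℝ, 0 ≤ C ∧ ∀ x : ℝ,
      |p.eval x * Real.exp (-(x ^ 2 / 2))| ≤ C * Real.exp (-(A * |x|)) := by
  induction p using Polynomial.induction_on' with
  | add p q hp hq =>
    obtain ⟨C, hC0, hC⟩ := hp
    obtain ⟨D, hD0, hD⟩ := hq
    refine ⟨C + D, by positivity, fun x => ?_⟩
    rw [Polynomial.eval_add, add_mul, add_mul]
    exact (abs_add_le _ _).trans (add_le_add (hC x) (hD x))
  | monomial n a =>
    refine ⟨|a| * n.factorial * Real.exp ((1 + A) ^ 2 / 2), by positivity, fun x => ?_⟩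
    rw [Polynomial.eval_monomial, abs_mul, abs_mul, abs_pow, Real.abs_exp]
    have h := Real.pow_div_factorial_le_exp |x| (abs_nonneg x) n
    rw [div_le_iff₀ (by positivity)] at h
    calc |a| * |x| ^ n * Real.exp (-(x ^ 2 / 2))
        ≤ |a| * (Real.exp |x| * n.factorial) * Real.exp (-(x ^ 2 / 2)) := by gcongr
      _ = |a| * n.factorial * Real.exp (|x| + -(x ^ 2 / 2)) := by rw [Real.exp_add]; ring
      _ ≤ |a| * n.factorial * Real.exp ((1 + A) ^ 2 / 2 + -(A * |x|)) := by
          refine mul_le_mul_of_nonneg_left (Real.exp_le_exp.2 ?_) (by positivity)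
          rw [← sq_abs x]
          nlinarith [sq_nonneg (|x| - (1 + A))]
      _ = _ := by rw [Real.exp_add]; ring

/-- Taylor expansion of a polynomial times a Gaussian, with an exponentially decaying remainder. -/
lemma exists_gaussian_taylor {A : ℝ} (hA : 0 ≤ A) (k : ℕ) (p : Polynomial ℝ) :
    ∃ (c : ℕ → ℝ → ℝ) (C : ℝ), 0 ≤ C ∧ ∀ u b : ℝ,
      |p.eval (u - b) * Real.exp (-((u - b) ^ 2 / 2)) - ∑ j ∈ Finset.range k, c j u * b ^ j| ≤
        C * |b| ^ k * (Real.exp (-(A * |u|)) * Real.exp (A * |b|)) := by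
  induction k generalizing p with
  | zero =>
    obtain ⟨C, hC0, hC⟩ := exists_gaussian_mul_polynomial_le A p
    refine ⟨0, C, hC0, fun u b => ?_⟩
    simp only [Finset.range_zero, Finset.sum_empty, sub_zero, pow_zero, mul_one]
    refine (hC (u - b)).trans ?_
    rw [← Real.exp_add]
    gcongr
    have := abs_sub_abs_le_abs_sub u b
    nlinarith
  | succ k ih =>
    set q : Polynomial ℝ := p.derivative - Polynomial.X * p with hq
    have hder : ∀ x : ℝ, HasDerivAt (fun x => p.eval x * Real.exp (-(x ^ 2 / 2)))
        (q.eval x * Real.exp (-(x ^ 2 / 2))) x := by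
      intro x
      have h1 : HasDerivAt (fun x : ℝ => -(x ^ 2 / 2)) (-x) x := by
        have := (((hasDerivAt_id x).pow 2).div_const 2).neg
        convert! this using 1
        simp
      convert! (p.hasDerivAt x).mul h1.exp using 1
      rw [hq]
      simp only [Polynomial.eval_sub, Polynomial.eval_mul, Polynomial.eval_X]
      ring
    obtain ⟨c, C, hC0, hC⟩ := ih q
    refine ⟨fun j u => if j = 0 then p.eval u * Real.exp (-(u ^ 2 / 2))
      else -(c (j - 1) u / j), C, hC0, fun u b => ?_⟩
    set F : ℝ → ℝ := fun τ => p.eval (u - τ) * Real.exp (-((u - τ) ^ 2 / 2)) +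
      ∑ j ∈ Finset.range k, c j u / (j + 1) * τ ^ (j + 1) with hF
    have hFd : ∀ τ, HasDerivAt F (-(q.eval (u - τ) * Real.exp (-((u - τ) ^ 2 / 2)) -
        ∑ j ∈ Finset.range k, c j u * τ ^ j)) τ := by
      intro τ
      have h1 := (hder (u - τ)).comp τ ((hasDerivAt_id τ).const_sub u)
      have h2 : HasDerivAt (fun τ : ℝ => ∑ j ∈ Finset.range k, c j u / (j + 1) * τ ^ (j + 1))
          (∑ j ∈ Finset.range k, c j u * τ ^ j) τ := by
        refine HasDerivAt.fun_sum fun j _ => ?_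
        have := ((hasDerivAt_id τ).pow (j + 1)).const_mul (c j u / (j + 1))
        convert! this using 1
        have : (j : ℝ) + 1 ≠ 0 := by positivity
        simp
        field_simp
      convert! h1.add h2 using 1
      ring
    have hb := Convex.norm_image_sub_le_of_norm_hasDerivWithin_le (s := Set.uIcc 0 b)
      (C := C * |b| ^ k * (Real.exp (-(A * |u|)) * Real.exp (A * |b|)))
      (fun τ _ => (hFd τ).hasDerivWithinAt) (fun τ hτ => ?_) (convex_uIcc 0 b)
      Set.left_mem_uIcc Set.right_mem_uIcc
    · have e : F b - F 0 = p.eval (u - b) * Real.exp (-((u - b) ^ 2 / 2)) -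
          ∑ j ∈ Finset.range (k + 1), (if j = 0 then p.eval u * Real.exp (-(u ^ 2 / 2))
            else -(c (j - 1) u / j)) * b ^ j := by
        rw [Finset.sum_range_succ']
        simp [hF, Finset.sum_neg_distrib]
        ring
      rw [e, Real.norm_eq_abs, Real.norm_eq_abs, sub_zero] at hb
      refine hb.trans (le_of_eq ?_)
      ring
    · have hle : |τ| ≤ |b| := by
        have := Set.abs_sub_left_of_mem_uIcc hτ
        simpa using this
      rw [norm_neg, Real.norm_eq_abs]
      refine (hC u τ).trans ?_
      gcongr

/-- The Fokker–Planck evolution in physical space: `e^{-t}` is the scale `s`, and the rescaled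
function is averaged against a centered Gaussian of variance `v`. -/
noncomputable def scaledGaussianAverage (s : ℝ) (v : NNReal) (f : ℝ → ℂ) (x : ℝ) : ℂ :=
  (s : ℂ)⁻¹ * ∫ z, f ((x - z) / s) ∂ProbabilityTheory.gaussianReal 0 v

lemma stronglyMeasurable_scaledGaussianAverage (s : ℝ) (v : NNReal) {f : ℝ → ℂ}
    (hf : StronglyMeasurable f) : StronglyMeasurable (scaledGaussianAverage s v f) := by
  refine StronglyMeasurable.const_mul (StronglyMeasurable.integral_prod_right ?_) _
  exact hf.comp_measurable (by fun_prop : Measurable fun p : ℝ × ℝ => (p.1 - p.2) / s)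

lemma integral_comp_sub_div {E : Type*} [NormedAddCommGroup E] [NormedSpace ℝ E] {s : ℝ}
    (hs : 0 < s) (z : ℝ) (G : ℝ → E) : ∫ x, G ((x - z) / s) = s • ∫ y, G y := by
  rw [integral_sub_right_eq_self (fun x => G (x / s)) z, Measure.integral_comp_div,
    abs_of_pos hs]

lemma lintegral_comp_sub_div {s : ℝ} (hs : 0 < s) (z : ℝ) {G : ℝ → ENNReal} (hG : Measurable G) :
    ∫⁻ x, G ((x - z) / s) = ENNReal.ofReal s * ∫⁻ y, G y := by
  rw [lintegral_sub_right_eq_self (fun x => G (x / s)) z]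
  have h := Real.map_volume_mul_right (inv_ne_zero hs.ne')
  rw [inv_inv, abs_of_pos hs] at h
  rw [← smul_eq_mul, ← lintegral_smul_measure, ← h, lintegral_map hG (by fun_prop)]
  simp only [div_eq_mul_inv]

lemma integrable_one_add_abs_pow_gaussianReal (v : NNReal) (m : ℕ) :
    Integrable (fun z : ℝ => (1 + |z|) ^ m) (ProbabilityTheory.gaussianReal 0 v) := by
  obtain ⟨C, -, hC⟩ := exists_one_add_abs_pow_le_exp one_pos m
  have h : Integrable (fun z : ℝ => Real.exp (1 * |z|)) (ProbabilityTheory.gaussianReal 0 v) :=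
    ProbabilityTheory.integrable_exp_mul_abs (X := fun z : ℝ => z)
      (ProbabilityTheory.integrable_exp_mul_gaussianReal 1)
      (ProbabilityTheory.integrable_exp_mul_gaussianReal (-1))
  refine (h.const_mul C).mono'
    (by fun_prop : Continuous fun z : ℝ => (1 + |z|) ^ m).aestronglyMeasurable
    (Filter.Eventually.of_forall fun z => ?_)
  rw [Real.norm_of_nonneg (by positivity)]
  exact hC z

/-- Duality formula for test functions of polynomial growth. -/
lemma integral_scaledGaussianAverage_mul {s : ℝ} (hs : 0 < s) (hs1 : s ≤ 1) (v : NNReal)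
    {f h : ℝ → ℂ} (hf : StronglyMeasurable f) (hh : Continuous h) (m : ℕ)
    (hm : ∀ x, ‖h x‖ ≤ (1 + |x|) ^ m) (hfm : Integrable fun y => ‖f y‖ * (1 + |y|) ^ m) :
    ∫ x, scaledGaussianAverage s v f x * h x =
      ∫ z, (∫ y, f y * h (z + s * y)) ∂ProbabilityTheory.gaussianReal 0 v := by
  set μ := ProbabilityTheory.gaussianReal 0 v with hμ
  set F : ℝ → ℝ → ℂ := fun x z => f ((x - z) / s) * h x with hF
  have hFG : ∀ z x, F x z = (fun y => f y * h (z + s * y)) ((x - z) / s) := by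
    intro z x
    simp only [hF]
    congr 2
    field_simp
    ring
  have hFm : StronglyMeasurable (Function.uncurry F) := by
    refine StronglyMeasurable.mul
      (hf.comp_measurable (by fun_prop : Measurable fun p : ℝ × ℝ => (p.1 - p.2) / s)) ?_
    exact (hh.comp continuous_fst).stronglyMeasurable
  have hbd : ∀ z y, ‖f y * h (z + s * y)‖ ≤ (1 + |z|) ^ m * (‖f y‖ * (1 + |y|) ^ m) := by
    intro z y
    have h1 : 1 + |z + s * y| ≤ (1 + |z|) * (1 + |y|) := by
      have h2 : |s * y| ≤ |y| := by
        rw [abs_mul, abs_of_pos hs]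
        exact mul_le_of_le_one_left (abs_nonneg y) hs1
      nlinarith [abs_add_le z (s * y), abs_nonneg z, abs_nonneg y,
        mul_nonneg (abs_nonneg z) (abs_nonneg y)]
    rw [norm_mul]
    calc ‖f y‖ * ‖h (z + s * y)‖ ≤ ‖f y‖ * ((1 + |z|) * (1 + |y|)) ^ m := by
          gcongr
          exact (hm _).trans (by gcongr)
      _ = _ := by rw [mul_pow]; ring
  have hint : ∀ z, Integrable fun y => f y * h (z + s * y) := fun z =>
    (hfm.const_mul ((1 + |z|) ^ m)).mono'
      (hf.mul (hh.comp (by fun_prop)).stronglyMeasurable).aestronglyMeasurable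
      (Filter.Eventually.of_forall (hbd z))
  have hFi : Integrable (Function.uncurry F) (volume.prod μ) := by
    rw [integrable_prod_iff' hFm.aestronglyMeasurable]
    refine ⟨Filter.Eventually.of_forall fun z => ?_, ?_⟩
    · simp only [Function.uncurry_apply_pair, hFG z]
      exact ((hint z).comp_div hs.ne').comp_sub_right z
    · refine (((integrable_one_add_abs_pow_gaussianReal v m).mul_const
        (∫ y, ‖f y‖ * (1 + |y|) ^ m)).const_mul s).mono' ?_
        (Filter.Eventually.of_forall fun z => ?_)
      · exact (StronglyMeasurable.integral_prod_left hFm.norm).aestronglyMeasurable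
      · rw [Real.norm_of_nonneg (integral_nonneg fun _ => norm_nonneg _)]
        simp only [Function.uncurry_apply_pair, hFG z]
        rw [integral_comp_sub_div hs z (fun y => ‖f y * h (z + s * y)‖), smul_eq_mul]
        refine mul_le_mul_of_nonneg_left ?_ hs.le
        rw [← integral_const_mul]
        exact integral_mono (hint z).norm (hfm.const_mul _) (hbd z)
  have hsC : (s : ℂ) ≠ 0 := by exact_mod_cast hs.ne'
  calc ∫ x, scaledGaussianAverage s v f x * h x
      = ∫ x, (s : ℂ)⁻¹ * ∫ z, F x z ∂μ := by
        refine integral_congr_ae (Filter.Eventually.of_forall fun x => ?_)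
        simp only [scaledGaussianAverage, hF, integral_mul_const, mul_assoc, hμ]
    _ = (s : ℂ)⁻¹ * ∫ z, (∫ x, F x z) ∂μ := by
        rw [integral_const_mul, integral_integral_swap hFi]
    _ = (s : ℂ)⁻¹ * ∫ z, (s : ℂ) * (∫ y, f y * h (z + s * y)) ∂μ := by
        congr 2
        funext z
        simp only [hFG z]
        rw [integral_comp_sub_div hs z (fun y => f y * h (z + s * y)), Complex.real_smul]
    _ = _ := by rw [integral_const_mul, inv_mul_cancel_left₀ hsC]

lemma FT_scaledGaussianAverage {s : ℝ} (hs : 0 < s) (hs1 : s ≤ 1) (v : NNReal)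
    {f : ℝ → ℂ} (hf : StronglyMeasurable f) (hfi : Integrable fun y => ‖f y‖) (ξ : ℝ) :
    FT (scaledGaussianAverage s v f) ξ =
      Complex.exp (-((v : ℝ) : ℂ) * (ξ : ℂ) ^ 2 / 2) * FT f (ξ * s) := by
  have hn : ∀ x : ℝ, ‖Complex.exp (-(Complex.I * x * ξ))‖ = 1 := by
    intro x
    have : -(Complex.I * x * ξ) = ((-(x * ξ) : ℝ) : ℂ) * Complex.I := by push_cast; ring
    rw [this, Complex.norm_exp_ofReal_mul_I]
  rw [FT, integral_scaledGaussianAverage_mul hs hs1 v hf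
    (h := fun x : ℝ => Complex.exp (-(Complex.I * x * ξ))) (by fun_prop) 0
    (fun x => by simp [hn]) (by simpa using hfi)]
  have e : ∀ z : ℝ, ∫ y, f y * Complex.exp (-(Complex.I * ((z + s * y : ℝ) : ℂ) * ξ)) =
      Complex.exp (((-ξ : ℝ) : ℂ) * z * Complex.I) * FT f (ξ * s) := by
    intro z
    rw [FT, ← integral_const_mul]
    refine integral_congr_ae (Filter.Eventually.of_forall fun y => ?_)
    simp only
    rw [mul_left_comm, ← Complex.exp_add]
    congr 2
    push_cast
    ring
  simp only [e]
  rw [integral_mul_const, ← charFun_apply_real, ProbabilityTheory.charFun_gaussianReal]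
  congr 2
  push_cast
  ring

lemma moment_scaledGaussianAverage_eq_zero {s : ℝ} (hs : 0 < s) (hs1 : s ≤ 1) (v : NNReal)
    {f : ℝ → ℂ} (hf : StronglyMeasurable f)
    (hfm : ∀ m : ℕ, Integrable fun y => ‖f y‖ * (1 + |y|) ^ m) {k : ℕ}
    (h0 : ∀ j < k, ∫ x : ℝ, f x * (x : ℂ) ^ j = 0) {j : ℕ} (hj : j < k) :
    ∫ x : ℝ, scaledGaussianAverage s v f x * (x : ℂ) ^ j = 0 := by
  rw [integral_scaledGaussianAverage_mul hs hs1 v hf (h := fun x : ℝ => (x : ℂ) ^ j)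
    (by fun_prop) j (fun x => ?_) (hfm j)]
  · have e : ∀ z : ℝ, ∫ y, f y * ((z + s * y : ℝ) : ℂ) ^ j = 0 := by
      intro z
      have e1 : ∀ y : ℝ, f y * ((z + s * y : ℝ) : ℂ) ^ j = ∑ i ∈ Finset.range (j + 1),
          (f y * (y : ℂ) ^ i) * ((s : ℂ) ^ i * (z : ℂ) ^ (j - i) * (j.choose i : ℂ)) := by
        intro y
        push_cast
        rw [add_comm (z : ℂ), add_pow, Finset.mul_sum]
        refine Finset.sum_congr rfl fun i _ => ?_
        rw [mul_pow]
        ring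
      simp only [e1]
      rw [integral_finsetSum]
      · refine Finset.sum_eq_zero fun i hi => ?_
        rw [integral_mul_const, h0 i (by have := Finset.mem_range.1 hi; omega), zero_mul]
      · intro i _
        refine Integrable.mul_const ((hfm i).mono' (hf.aestronglyMeasurable.fun_mul
          (by fun_prop : Continuous fun y : ℝ => (y : ℂ) ^ i).aestronglyMeasurable)
          (Filter.Eventually.of_forall fun y => ?_)) _
        rw [norm_mul, norm_pow, Complex.norm_real, Real.norm_eq_abs]
        gcongr
        linarith
    simp only [e, integral_zero]
  · rw [norm_pow, Complex.norm_real, Real.norm_eq_abs]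
    gcongr
    linarith

lemma enorm_sq_mul_cosh (β x : ℝ) (w : ℂ) :
    ‖w‖ₑ ^ 2 * ENNReal.ofReal (Real.cosh (β * x)) =
      ENNReal.ofReal (‖w‖ ^ 2 * Real.cosh (β * x)) := by
  rw [← ofReal_norm, ← ENNReal.ofReal_pow (norm_nonneg _), ← ENNReal.ofReal_mul (by positivity)]

lemma memE.lintegral_eq {β : ℝ} {f : ℝ → ℂ} (hf : memE β f) :
    ∫⁻ x, ‖f x‖ₑ ^ 2 * ENNReal.ofReal (Real.cosh (β * x)) = ENNReal.ofReal (normE β f ^ 2) := by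
  have h0 : ∀ x, 0 ≤ ‖f x‖ ^ 2 * Real.cosh (β * x) := fun x => by
    have := Real.cosh_pos (β * x); positivity
  simp only [enorm_sq_mul_cosh]
  rw [normE, Real.sq_sqrt (integral_nonneg h0),
    ofReal_integral_eq_lintegral_ofReal hf.2 (Filter.Eventually.of_forall h0)]

lemma memE_and_normE_le_of_lintegral_le {β c : ℝ} (hc : 0 ≤ c) {g : ℝ → ℂ}
    (hg : AEStronglyMeasurable g)
    (h : ∫⁻ x, ‖g x‖ₑ ^ 2 * ENNReal.ofReal (Real.cosh (β * x)) ≤ ENNReal.ofReal (c ^ 2)) :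
    memE β g ∧ normE β g ≤ c := by
  have h0 : ∀ x, 0 ≤ ‖g x‖ ^ 2 * Real.cosh (β * x) := fun x => by
    have := Real.cosh_pos (β * x); positivity
  have hm : AEStronglyMeasurable fun x => ‖g x‖ ^ 2 * Real.cosh (β * x) :=
    (hg.norm.pow 2).mul
      (Real.continuous_cosh.comp (continuous_const.mul continuous_id)).aestronglyMeasurable
  simp only [enorm_sq_mul_cosh] at h
  have hgE : memE β g := by
    refine ⟨hg, hm, ?_⟩
    rw [hasFiniteIntegral_iff_ofReal (Filter.Eventually.of_forall h0)]
    exact h.trans_lt ENNReal.ofReal_lt_top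
  refine ⟨hgE, ?_⟩
  rw [← ofReal_integral_eq_lintegral_ofReal hgE.2 (Filter.Eventually.of_forall h0),
    ENNReal.ofReal_le_ofReal_iff (by positivity)] at h
  rw [normE, ← Real.sqrt_sq hc]
  exact Real.sqrt_le_sqrt h

lemma lintegral_sq_le_of_isProbabilityMeasure {α : Type*} [MeasurableSpace α] (μ : Measure α)
    [IsProbabilityMeasure μ] {u : α → ENNReal} (hu : AEMeasurable u μ) :
    (∫⁻ x, u x ∂μ) ^ 2 ≤ ∫⁻ x, u x ^ 2 ∂μ := by
  have h := ENNReal.lintegral_mul_le_Lp_mul_Lq μ Real.HolderConjugate.two_two hu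
    (aemeasurable_const (b := (1 : ENNReal)))
  have h1 : ∫⁻ x, u x ∂μ ≤ (∫⁻ x, u x ^ 2 ∂μ) ^ (1 / 2 : ℝ) := by simpa using h
  refine (pow_le_pow_left' h1 2).trans (le_of_eq ?_)
  rw [← ENNReal.rpow_natCast, ← ENNReal.rpow_mul]
  norm_num

lemma lintegral_two_mul_cosh_gaussianReal_le (β : ℝ) {v : NNReal} (hv : v ≤ 1) :
    ∫⁻ z, ENNReal.ofReal (2 * Real.cosh (β * z)) ∂ProbabilityTheory.gaussianReal 0 v ≤
      ENNReal.ofReal (2 * Real.exp (β ^ 2 / 2)) := by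
  have hmgf : ∀ t : ℝ, ∫ z, Real.exp (t * z) ∂ProbabilityTheory.gaussianReal 0 v =
      Real.exp (v * t ^ 2 / 2) := by
    intro t
    have h := ProbabilityTheory.mgf_gaussianReal (p := ProbabilityTheory.gaussianReal 0 v)
      (X := fun z : ℝ => z) (by exact Measure.map_id) t
    rw [ProbabilityTheory.mgf] at h
    simpa using h
  have hi := fun t : ℝ => ProbabilityTheory.integrable_exp_mul_gaussianReal (μ := 0) (v := v) t
  have e : (fun z : ℝ => 2 * Real.cosh (β * z)) =
      fun z => Real.exp (β * z) + Real.exp (-β * z) := by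
    funext z; rw [Real.cosh_eq, neg_mul]; ring
  rw [← ofReal_integral_eq_lintegral_ofReal (by rw [e]; exact (hi β).add (hi (-β)))
    (Filter.Eventually.of_forall fun z => by have := Real.cosh_pos (β * z); positivity), e,
    integral_add (hi β) (hi (-β)), hmgf, hmgf]
  refine ENNReal.ofReal_le_ofReal ?_
  have hv' : (v : ℝ) ≤ 1 := by exact_mod_cast hv
  have : Real.exp (v * β ^ 2 / 2) ≤ Real.exp (β ^ 2 / 2) :=
    Real.exp_le_exp.2 (by nlinarith [sq_nonneg β])
  rw [neg_sq]
  linarith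

lemma scaledGaussianAverage_memE_and_normE_le {β s : ℝ} (hs : 0 < s) (hs1 : s ≤ 1) {v : NNReal}
    (hv : v ≤ 1) {f : ℝ → ℂ} (hf : StronglyMeasurable f) (hfE : memE β f) :
    memE β (scaledGaussianAverage s v f) ∧ normE β (scaledGaussianAverage s v f) ≤
      Real.sqrt (s⁻¹ * (2 * Real.exp (β ^ 2 / 2))) * normE β f := by
  set μ := ProbabilityTheory.gaussianReal 0 v with hμ
  have hch : Measurable fun x : ℝ => ENNReal.ofReal (Real.cosh (β * x)) :=
    (Real.continuous_cosh.measurable.comp (measurable_const_mul β)).ennreal_ofReal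
  have hfe : Measurable fun x => ‖f x‖ₑ := hf.measurable.enorm
  have hn0 : 0 ≤ normE β f := Real.sqrt_nonneg _
  refine memE_and_normE_le_of_lintegral_le (by positivity)
    (stronglyMeasurable_scaledGaussianAverage s v hf).aestronglyMeasurable ?_
  have hsub : Measurable fun p : ℝ × ℝ => (p.1 - p.2) / s := by fun_prop
  have hpt : ∀ x, ‖scaledGaussianAverage s v f x‖ₑ ^ 2 ≤
      ENNReal.ofReal (s⁻¹ ^ 2) * ∫⁻ z, ‖f ((x - z) / s)‖ₑ ^ 2 ∂μ := by
    intro x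
    rw [scaledGaussianAverage, enorm_mul, mul_pow]
    gcongr
    · rw [← ofReal_norm, ENNReal.ofReal_pow (by positivity), norm_inv, Complex.norm_real,
        Real.norm_of_nonneg hs.le]
    · refine le_trans (pow_le_pow_left' (enorm_integral_le_lintegral_enorm _) 2) ?_
      exact lintegral_sq_le_of_isProbabilityMeasure μ
        (hfe.comp (by fun_prop : Measurable fun z : ℝ => (x - z) / s)).aemeasurable
  have hcosh : ∀ z y : ℝ, ENNReal.ofReal (Real.cosh (β * (z + s * y))) ≤
      ENNReal.ofReal (2 * Real.cosh (β * z)) * ENNReal.ofReal (Real.cosh (β * y)) := by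
    intro z y
    have hz := Real.cosh_pos (β * z)
    rw [← ENNReal.ofReal_mul (by positivity)]
    refine ENNReal.ofReal_le_ofReal ?_
    rw [mul_add]
    refine (cosh_add_le_two_mul _ _).trans ?_
    gcongr
    rw [Real.cosh_le_cosh, mul_left_comm, abs_mul, abs_of_pos hs]
    exact mul_le_of_le_one_left (abs_nonneg _) hs1
  have hslice : ∀ z, ∫⁻ x, ‖f ((x - z) / s)‖ₑ ^ 2 * ENNReal.ofReal (Real.cosh (β * x)) ≤
      ENNReal.ofReal s * (ENNReal.ofReal (2 * Real.cosh (β * z)) *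
        ENNReal.ofReal (normE β f ^ 2)) := by
    intro z
    have e : ∀ x, ‖f ((x - z) / s)‖ₑ ^ 2 * ENNReal.ofReal (Real.cosh (β * x)) =
        (fun y => ‖f y‖ₑ ^ 2 * ENNReal.ofReal (Real.cosh (β * (z + s * y)))) ((x - z) / s) := by
      intro x
      have : z + s * ((x - z) / s) = x := by field_simp; ring
      simp only [this]
    simp only [e]
    have hG : Measurable fun y => ‖f y‖ₑ ^ 2 * ENNReal.ofReal (Real.cosh (β * (z + s * y))) :=
      (hfe.pow_const 2).mul (hch.comp (by fun_prop : Measurable fun y : ℝ => z + s * y))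
    have hG' : Measurable fun y => ‖f y‖ₑ ^ 2 * ENNReal.ofReal (Real.cosh (β * y)) :=
      (hfe.pow_const 2).mul hch
    rw [lintegral_comp_sub_div hs z hG, ← hfE.lintegral_eq, ← lintegral_const_mul _ hG']
    refine mul_le_mul_right (lintegral_mono fun y => ?_) _
    rw [mul_left_comm]
    gcongr
    exact hcosh z y
  calc ∫⁻ x, ‖scaledGaussianAverage s v f x‖ₑ ^ 2 * ENNReal.ofReal (Real.cosh (β * x))
      ≤ ∫⁻ x, ENNReal.ofReal (s⁻¹ ^ 2) *
          ∫⁻ z, ‖f ((x - z) / s)‖ₑ ^ 2 * ENNReal.ofReal (Real.cosh (β * x)) ∂μ := by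
        refine lintegral_mono fun x => ?_
        have hG : Measurable fun z => ‖f ((x - z) / s)‖ₑ ^ 2 :=
          (hfe.comp (by fun_prop : Measurable fun z : ℝ => (x - z) / s)).pow_const 2
        rw [lintegral_mul_const _ hG, ← mul_assoc]
        gcongr
        exact hpt x
    _ = ENNReal.ofReal (s⁻¹ ^ 2) *
          ∫⁻ z, (∫⁻ x, ‖f ((x - z) / s)‖ₑ ^ 2 * ENNReal.ofReal (Real.cosh (β * x))) ∂μ := by
        have hM : Measurable (Function.uncurry fun x z : ℝ =>
            ‖f ((x - z) / s)‖ₑ ^ 2 * ENNReal.ofReal (Real.cosh (β * x))) :=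
          ((hfe.comp hsub).pow_const 2).mul (hch.comp measurable_fst)
        rw [lintegral_const_mul _ hM.lintegral_prod_right, lintegral_lintegral_swap hM.aemeasurable]
    _ ≤ ENNReal.ofReal (s⁻¹ ^ 2) * ∫⁻ z, ENNReal.ofReal s *
          (ENNReal.ofReal (2 * Real.cosh (β * z)) * ENNReal.ofReal (normE β f ^ 2)) ∂μ := by
        gcongr with z
        exact hslice z
    _ = ENNReal.ofReal (s⁻¹ ^ 2) * (ENNReal.ofReal s *
          ((∫⁻ z, ENNReal.ofReal (2 * Real.cosh (β * z)) ∂μ) *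
            ENNReal.ofReal (normE β f ^ 2))) := by
        have hM : Measurable fun z : ℝ => ENNReal.ofReal (2 * Real.cosh (β * z)) :=
          ((Real.continuous_cosh.measurable.comp (measurable_const_mul β)).const_mul
            2).ennreal_ofReal
        rw [lintegral_const_mul _ (hM.mul_const _), lintegral_mul_const _ hM]
    _ ≤ ENNReal.ofReal (s⁻¹ ^ 2) * (ENNReal.ofReal s *
          (ENNReal.ofReal (2 * Real.exp (β ^ 2 / 2)) * ENNReal.ofReal (normE β f ^ 2))) := by
        gcongr
        exact lintegral_two_mul_cosh_gaussianReal_le β hv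
    _ = _ := by
        rw [← ENNReal.ofReal_mul (by positivity), ← ENNReal.ofReal_mul (by positivity),
          ← ENNReal.ofReal_mul (by positivity), mul_pow, Real.sq_sqrt (by positivity)]
        congr 1
        field_simp

lemma scaledGaussianAverage_eq_integral_density {s : ℝ} (hs : 0 < s) {v : NNReal} (hv : v ≠ 0)
    (f : ℝ → ℂ) (x : ℝ) : scaledGaussianAverage s v f x =
      ∫ y, f y * (ProbabilityTheory.gaussianPDFReal 0 v (x - s * y) : ℂ) := by
  have hsC : (s : ℂ) ≠ 0 := by exact_mod_cast hs.ne'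
  rw [scaledGaussianAverage, ProbabilityTheory.integral_gaussianReal_eq_integral_smul hv,
    ← integral_sub_left_eq_self _ volume x]
  have e : ∀ w : ℝ, ProbabilityTheory.gaussianPDFReal 0 v (x - w) • f ((x - (x - w)) / s) =
      (fun y => f y * (ProbabilityTheory.gaussianPDFReal 0 v (x - s * y) : ℂ)) (w / s) := by
    intro w
    rw [sub_sub_cancel, Complex.real_smul, mul_comm]
    simp only
    rw [mul_div_cancel₀ w hs.ne']
  simp only [e]
  rw [Measure.integral_comp_div
    (fun y => f y * (ProbabilityTheory.gaussianPDFReal 0 v (x - s * y) : ℂ)), abs_of_pos hs,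
    Complex.real_smul, inv_mul_cancel_left₀ hsC]

/-- For small scales, vanishing moments give decay in the scale, with exponential tails. -/
lemma exists_norm_scaledGaussianAverage_le {β : ℝ} (hβ : 0 < β) (k : ℕ) :
    ∃ K : ℝ, 0 < K ∧ ∀ (s : ℝ) (v : NNReal), 0 < s → s ≤ 1 / 16 → 1 / 4 ≤ v → v ≤ 1 →
      ∀ f : ℝ → ℂ, memEk β k f → ∀ x,
        ‖scaledGaussianAverage s v f x‖ ≤ K * s ^ k * Real.exp (-(β * |x|)) * normE β f := by
  obtain ⟨c, C, hC0, hC⟩ := exists_gaussian_taylor hβ.le k 1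
  obtain ⟨C₁, hC₁0, hC₁⟩ := exists_one_add_abs_pow_le_exp (c := β / 8) (by positivity) k
  obtain ⟨D, hD0, hD⟩ := exists_integral_norm_mul_exp_le hβ
  refine ⟨2 * C * 2 ^ k * C₁ * D + 1, by positivity, fun s v hs hs1 hv hv1 f hf x => ?_⟩
  have hv0 : v ≠ 0 := by rintro rfl; norm_num at hv
  have hvR : (1 / 4 : ℝ) ≤ v := by exact_mod_cast hv
  have hvR1 : (v : ℝ) ≤ 1 := by exact_mod_cast hv1
  set σ := Real.sqrt v with hσ
  have hσ2 : σ ^ 2 = v := Real.sq_sqrt v.2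
  have hσh : 1 / 2 ≤ σ := Real.le_sqrt_of_sq_le (by norm_num; linarith)
  have hσ1 : σ ≤ 1 := Real.sqrt_le_one.2 hvR1
  have hσ0 : 0 < σ := by linarith
  set a := (Real.sqrt (2 * Real.pi * v))⁻¹ with ha
  have ha0 : 0 ≤ a := by positivity
  have ha2 : a ≤ 2 := by
    have : (1 / 2 : ℝ) ≤ Real.sqrt (2 * Real.pi * v) :=
      Real.le_sqrt_of_sq_le (by nlinarith [Real.pi_gt_three])
    calc a ≤ (1 / 2 : ℝ)⁻¹ := inv_anti₀ (by norm_num) this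
      _ = 2 := by norm_num
  have hn0 : 0 ≤ normE β f := Real.sqrt_nonneg _
  have hfm := fun m : ℕ => memE.integrable_norm_mul_one_add_abs_pow hβ hf.1 m
  have hfj : ∀ j : ℕ, Integrable fun y => f y * (y : ℂ) ^ j := fun j =>
    (hfm j).mono' (hf.1.1.fun_mul
      (by fun_prop : Continuous fun y : ℝ => (y : ℂ) ^ j).aestronglyMeasurable)
      (Filter.Eventually.of_forall fun y => by
        rw [norm_mul, norm_pow, Complex.norm_real, Real.norm_eq_abs]
        gcongr
        linarith)
  set P : ℝ → ℝ := fun y => ∑ j ∈ Finset.range k, c j (x / σ) * (s * y / σ) ^ j with hP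
  set R : ℝ → ℝ := fun y => Real.exp (-((x / σ - s * y / σ) ^ 2 / 2)) - P y with hR
  have hPe : ∀ y : ℝ, f y * (P y : ℂ) = ∑ j ∈ Finset.range k,
      (f y * (y : ℂ) ^ j) * ((c j (x / σ) : ℂ) * ((s : ℂ) / σ) ^ j) := by
    intro y
    simp only [hP]
    push_cast
    rw [Finset.mul_sum]
    refine Finset.sum_congr rfl fun j _ => ?_
    rw [mul_div_right_comm, mul_pow]
    ring
  have hPi : Integrable fun y => f y * (P y : ℂ) := by
    simp only [hPe]
    exact integrable_finsetSum _ fun j _ => (hfj j).mul_const _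
  have hP0 : ∫ y, f y * (P y : ℂ) = 0 := by
    simp only [hPe]
    rw [integral_finsetSum _ fun j _ => (hfj j).mul_const _]
    refine Finset.sum_eq_zero fun j hj => ?_
    rw [integral_mul_const, hf.2 j (Finset.mem_range.1 hj), zero_mul]
  set M := C * (2 * s) ^ k * C₁ * Real.exp (-(β * |x|)) with hM
  have hbd : ∀ y, ‖f y * (R y : ℂ)‖ ≤ M * (‖f y‖ * Real.exp (β / 4 * |y|)) := by
    intro y
    have h := hC (x / σ) (s * y / σ)
    rw [Polynomial.eval_one, one_mul] at h
    have hb : |s * y / σ| ≤ 2 * s * |y| := by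
      rw [abs_div, abs_mul, abs_of_pos hs, abs_of_pos hσ0, div_le_iff₀ hσ0]
      nlinarith [mul_nonneg hs.le (abs_nonneg y)]
    have hu : |x| ≤ |x / σ| := by
      rw [abs_div, abs_of_pos hσ0, le_div_iff₀ hσ0]
      exact mul_le_of_le_one_right (abs_nonneg x) hσ1
    have h1 : Real.exp (-(β * |x / σ|)) ≤ Real.exp (-(β * |x|)) :=
      Real.exp_le_exp.2 (neg_le_neg (mul_le_mul_of_nonneg_left hu hβ.le))
    have h2 : Real.exp (β * |s * y / σ|) ≤ Real.exp (β / 8 * |y|) := by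
      refine Real.exp_le_exp.2 ?_
      have : 2 * s * |y| ≤ |y| / 8 := by nlinarith [abs_nonneg y]
      nlinarith
    have h3 : |y| ^ k ≤ C₁ * Real.exp (β / 8 * |y|) :=
      (pow_le_pow_left₀ (abs_nonneg y) (by linarith) k).trans (hC₁ y)
    have h4 : |s * y / σ| ^ k ≤ (2 * s) ^ k * (C₁ * Real.exp (β / 8 * |y|)) := by
      refine (pow_le_pow_left₀ (abs_nonneg _) hb k).trans ?_
      rw [mul_pow]
      gcongr
    rw [norm_mul, Complex.norm_real, Real.norm_eq_abs]
    calc ‖f y‖ * |R y| ≤ ‖f y‖ * (C * ((2 * s) ^ k * (C₁ * Real.exp (β / 8 * |y|))) *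
          (Real.exp (-(β * |x|)) * Real.exp (β / 8 * |y|))) := by
          gcongr
          refine h.trans ?_
          gcongr
      _ = M * (‖f y‖ * (Real.exp (β / 8 * |y|) * Real.exp (β / 8 * |y|))) := by
          rw [hM]; ring
      _ = _ := by rw [← Real.exp_add]; congr 3; ring
  obtain ⟨hDi, hDle⟩ := hD f hf.1
  have hRc : Continuous fun y => (R y : ℂ) := by
    simp only [hR, hP]
    fun_prop
  have hRi : Integrable fun y => f y * (R y : ℂ) :=
    (hDi.const_mul M).mono' (hf.1.1.fun_mul hRc.aestronglyMeasurable)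
      (Filter.Eventually.of_forall hbd)
  have hg : scaledGaussianAverage s v f x = (a : ℂ) * ∫ y, f y * (R y : ℂ) := by
    rw [scaledGaussianAverage_eq_integral_density hs hv0, ← add_zero (∫ y, f y * (R y : ℂ)),
      ← hP0, ← integral_add hRi hPi, ← integral_const_mul]
    refine integral_congr_ae (Filter.Eventually.of_forall fun y => ?_)
    have e : -(x - s * y - 0) ^ 2 / (2 * (v : ℝ)) = -((x / σ - s * y / σ) ^ 2 / 2) := by
      rw [← hσ2]
      field_simp
      ring
    simp only [ProbabilityTheory.gaussianPDFReal_def, e, hR, ← ha]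
    push_cast
    ring
  rw [hg, norm_mul, Complex.norm_real, Real.norm_of_nonneg ha0]
  have hM0 : 0 ≤ M := by positivity
  have hI : ‖∫ y, f y * (R y : ℂ)‖ ≤ M * (D * normE β f) := by
    refine (norm_integral_le_of_norm_le (hDi.const_mul M)
      (Filter.Eventually.of_forall hbd)).trans ?_
    rw [integral_const_mul]
    gcongr
  calc a * ‖∫ y, f y * (R y : ℂ)‖ ≤ 2 * (M * (D * normE β f)) := by gcongr
    _ = (2 * C * 2 ^ k * C₁ * D) * (s ^ k * Real.exp (-(β * |x|)) * normE β f) := by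
        rw [hM, mul_pow]; ring
    _ ≤ (2 * C * 2 ^ k * C₁ * D + 1) * (s ^ k * Real.exp (-(β * |x|)) * normE β f) := by
        gcongr
        linarith
    _ = _ := by ring

lemma exists_normE_le_of_norm_le_exp {β : ℝ} (hβ : 0 < β) :
    ∃ J : ℝ, 0 < J ∧ ∀ (g : ℝ → ℂ) (L : ℝ), 0 ≤ L →
      (∀ x, ‖g x‖ ≤ L * Real.exp (-(β * |x|))) → normE β g ≤ J * L := by
  set I := ∫ x : ℝ, Real.exp (-(β * |x|)) with hI
  refine ⟨Real.sqrt I + 1, by positivity, fun g L hL hg => ?_⟩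
  have h : ∫ x, ‖g x‖ ^ 2 * Real.cosh (β * x) ≤ L ^ 2 * I := by
    rw [hI, ← integral_const_mul]
    refine integral_mono_of_nonneg (Filter.Eventually.of_forall fun x => ?_)
      ((integrable_exp_neg_mul_abs hβ).const_mul _) (Filter.Eventually.of_forall fun x => ?_)
    · have := Real.cosh_pos (β * x)
      simp only [Pi.zero_apply]
      positivity
    · calc ‖g x‖ ^ 2 * Real.cosh (β * x)
          ≤ (L * Real.exp (-(β * |x|))) ^ 2 * Real.exp (β * |x|) := by
            gcongr
            · exact hg x
            · exact cosh_le_exp_mul_abs hβ.le x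
        _ = L ^ 2 * Real.exp (-(β * |x|)) *
            (Real.exp (-(β * |x|)) * Real.exp (β * |x|)) := by ring
        _ = L ^ 2 * Real.exp (-(β * |x|)) := by
            rw [← Real.exp_add, neg_add_cancel, Real.exp_zero, mul_one]
  rw [normE]
  refine (Real.sqrt_le_sqrt h).trans ?_
  rw [Real.sqrt_mul (by positivity), Real.sqrt_sq hL]
  nlinarith [Real.sqrt_nonneg I]

lemma exists_normE_scaledGaussianAverage_le {β : ℝ} (hβ : 0 < β) (k : ℕ) :
    ∃ C : ℝ, 0 < C ∧ ∀ (s : ℝ) (v : NNReal), 0 < s → s ≤ 1 → (v : ℝ) = 1 - s ^ 2 →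
      ∀ f : ℝ → ℂ, StronglyMeasurable f → memEk β k f →
        normE β (scaledGaussianAverage s v f) ≤ C * s ^ k * normE β f := by
  obtain ⟨K, hK0, hK⟩ := exists_norm_scaledGaussianAverage_le hβ k
  obtain ⟨J, hJ0, hJ⟩ := exists_normE_le_of_norm_le_exp hβ
  set B := Real.sqrt (16 * (2 * Real.exp (β ^ 2 / 2))) * 16 ^ k with hB
  refine ⟨J * K + B, by positivity, fun s v hs hs1 hv f hf hfk => ?_⟩
  have hn0 : 0 ≤ normE β f := Real.sqrt_nonneg _
  have hv1 : v ≤ 1 := by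
    rw [← NNReal.coe_le_coe, hv, NNReal.coe_one]
    nlinarith
  have hB0 : 0 ≤ B := by positivity
  have hX : 0 ≤ s ^ k * normE β f := by positivity
  rcases le_total s (1 / 16) with h | h
  · have hv4 : 1 / 4 ≤ v := by
      rw [← NNReal.coe_le_coe, hv]
      push_cast
      nlinarith
    have h1 := hJ _ (K * s ^ k * normE β f) (by positivity) fun x =>
      (hK s v hs h hv4 hv1 f hfk x).trans (le_of_eq (by ring))
    nlinarith [mul_nonneg hB0 hX]
  · have h1 := (scaledGaussianAverage_memE_and_normE_le hs hs1 hv1 hf hfk.1).2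
    have h2 : Real.sqrt (s⁻¹ * (2 * Real.exp (β ^ 2 / 2))) ≤ B * s ^ k := by
      have hinv : s⁻¹ ≤ 16 := by
        rw [inv_le_comm₀ hs (by norm_num)]
        linarith
      have hpow : 1 ≤ 16 ^ k * s ^ k := by
        rw [← mul_pow]
        exact one_le_pow₀ (by linarith)
      rw [hB, mul_assoc]
      refine le_trans ?_ (le_mul_of_one_le_right (by positivity) hpow)
      gcongr
    have h3 := h1.trans (mul_le_mul_of_nonneg_right h2 hn0)
    have hJK : 0 ≤ J * K := by positivity
    nlinarith [mul_nonneg hJK hX]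

/-- for every `k` there is `C_k > 0` such that for every `t ≥ 0` and every
`f ∈ ℰ_k`, the function `S(t)f ∈ ℰ` determined on the Fourier side by
`ℱ[S(t)f](ξ) = exp(−(ξ²/2)(1−e^{−2t})) f̂(ξe^{−t})` lies again in `ℰ_k` and satisfies
`‖S(t)f‖_ω ≤ C_k e^{−kt} ‖f‖_ω`. -/
theorem semigroup_decay_on_Ek (β : ℝ) (hβ : 0 < β) (k : ℕ) :
    ∃ C : ℝ, 0 < C ∧ ∀ t : ℝ, 0 ≤ t → ∀ f : ℝ → ℂ, memEk β k f →
      ∃ g : ℝ → ℂ, memE β g ∧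
        (∀ᵐ ξ : ℝ ∂volume,
          FT g ξ = Complex.exp (-((ξ : ℂ) ^ 2 / 2) * (1 - Real.exp (-2 * t)))
              * FT f (ξ * Real.exp (-t))) ∧
        memEk β k g ∧
        normE β g ≤ C * Real.exp (-(k : ℝ) * t) * normE β f := by
  obtain ⟨C, hC0, hC⟩ := exists_normE_scaledGaussianAverage_le hβ k
  refine ⟨C, hC0, fun t ht f hf => ?_⟩
  set f' : ℝ → ℂ := hf.1.1.mk f with hf'
  have hae : f =ᵐ[volume] f' := hf.1.1.ae_eq_mk
  have hfm : StronglyMeasurable f' := hf.1.1.stronglyMeasurable_mk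
  have hsq : (fun x => ‖f x‖ ^ 2 * Real.cosh (β * x)) =ᵐ[volume]
      fun x => ‖f' x‖ ^ 2 * Real.cosh (β * x) := by
    filter_upwards [hae] with x hx
    rw [hx]
  have hE : memE β f' := ⟨hfm.aestronglyMeasurable, hf.1.2.congr hsq⟩
  have hnorm : normE β f' = normE β f := by
    rw [normE, normE, integral_congr_ae hsq]
  have hmom : ∀ j < k, ∫ x : ℝ, f' x * (x : ℂ) ^ j = 0 := by
    intro j hj
    rw [← hf.2 j hj]
    refine integral_congr_ae ?_
    filter_upwards [hae] with x hx
    rw [hx]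
  have hFT : ∀ ξ, FT f' ξ = FT f ξ := by
    intro ξ
    refine integral_congr_ae ?_
    filter_upwards [hae] with x hx
    rw [hx]
  set s := Real.exp (-t) with hs
  have hs0 : 0 < s := Real.exp_pos _
  have hs1 : s ≤ 1 := Real.exp_le_one_iff.2 (by linarith)
  have hs2 : s ^ 2 = Real.exp (-2 * t) := by
    rw [hs, ← Real.exp_nat_mul]
    congr 1
    push_cast
    ring
  have hv0 : 0 ≤ 1 - s ^ 2 := by nlinarith
  set v : NNReal := ⟨1 - s ^ 2, hv0⟩ with hv
  have hvc : (v : ℝ) = 1 - s ^ 2 := rfl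
  have hv1 : v ≤ 1 := by
    rw [← NNReal.coe_le_coe, hvc, NNReal.coe_one]
    nlinarith
  have hint := memE.integrable_norm_mul_one_add_abs_pow hβ hE
  have hgE := (scaledGaussianAverage_memE_and_normE_le hs0 hs1 hv1 hfm hE).1
  refine ⟨scaledGaussianAverage s v f', hgE, Filter.Eventually.of_forall fun ξ => ?_,
    ⟨hgE, fun j hj => moment_scaledGaussianAverage_eq_zero hs0 hs1 v hfm hint hmom hj⟩, ?_⟩
  · rw [FT_scaledGaussianAverage hs0 hs1 v hfm (by simpa using hint 0), hFT, hvc, hs2]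
    congr 2
    push_cast
    ring
  · have h := hC s v hs0 hs1 hvc f' hfm ⟨hE, hmom⟩
    have hpow : s ^ k = Real.exp (-(k : ℝ) * t) := by
      rw [hs, ← Real.exp_nat_mul]
      congr 1
      ring
    rwa [hnorm, hpow] at h
end
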